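/- With the notation of the context: (a) all elements of w⁻¹U'_{+,w}w, of w⁻¹T'w, of w⁻¹Q₁w and of w⁻¹Q₂w lie in P'; (b) the map Ψ: S̃ × Z → K\GL(a+b,k), (g, (z₁, z₂, z₃, z₄)) ↦ K·g·z₁z₂z₃z₄, is injective, where Z = (w⁻¹U'_{+,w}w) × (w⁻¹T'w) × (w⁻¹Q₁w) × (w⁻¹Q₂w); (c) for every subset D ⊆ GL(a+b,k) satisfying K·D·P' = D, the map Ψ restricts to a bijection from (S̃ ∩ D) × Z onto {Kx : x ∈ D} ∩ Ψ(S̃ × Z). -/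

import Mathlib

open Matrix

abbrev inBlk (off len i : ℕ) : Prop := off ≤ i ∧ i < off + len

abbrev Jpos (roff coff len i j : ℕ) : Prop :=
  inBlk roff len i ∧ inBlk coff len j ∧ (i - roff) + (j - coff) = len - 1

abbrev Ipos (roff coff len i j : ℕ) : Prop :=
  inBlk roff len i ∧ inBlk coff len j ∧ i - roff = j - coff

/-- The permutation matrix `w`: block rows `(s, r, q, t, r, s)`, block columns
`(s, s, r, q, t, r)`; nonzero blocks `(1,2)=J`, `(2,6)=J`, `(3,4)=J`, `(4,5)=1`,
`(5,3)=J`, `(6,1)=J`. -/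
def wMat (k : Type*) [Field k] (q r s t : ℕ) :
    Matrix (Fin (q + r + s + (t + r + s))) (Fin (q + r + s + (t + r + s))) k :=
  Matrix.of fun i j =>
    if Jpos 0 s s (i : ℕ) (j : ℕ) ∨
       Jpos s (2 * s + r + q + t) r (i : ℕ) (j : ℕ) ∨
       Jpos (s + r) (2 * s + r) q (i : ℕ) (j : ℕ) ∨
       Ipos (s + r + q) (2 * s + r + q) t (i : ℕ) (j : ℕ) ∨
       Jpos (s + r + q + t) (2 * s) r (i : ℕ) (j : ℕ) ∨
       Jpos (s + r + q + t + r) 0 s (i : ℕ) (j : ℕ)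
    then 1 else 0

/-- The group `B'` (block rows and columns `(s, r, q, t, r, s)`): block lower triangular
with diagonal blocks (invertible lower triangular, invertible lower triangular, identity,
identity, unipotent lower triangular, unipotent lower triangular), the `(4,3)` block
zero, other below-diagonal blocks arbitrary. -/
def bPrime (k : Type*) [Field k] (q r s t : ℕ) :
    Set (Matrix (Fin (q + r + s + (t + r + s))) (Fin (q + r + s + (t + r + s))) k) :=
  {g | (∀ i j : Fin (q + r + s + (t + r + s)), (i : ℕ) < (j : ℕ) → g i j = 0) ∧
    (∀ i : Fin (q + r + s + (t + r + s)), (i : ℕ) < s + r → g i i ≠ 0) ∧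
    (∀ i j : Fin (q + r + s + (t + r + s)),
      inBlk (s + r) (q + t) (i : ℕ) → inBlk (s + r) (q + t) (j : ℕ) →
      g i j = if (i : ℕ) = (j : ℕ) then 1 else 0) ∧
    (∀ i : Fin (q + r + s + (t + r + s)), s + r + q + t ≤ (i : ℕ) → g i i = 1)}

/-- The unipotent radical `U'` of `B'`. -/
def uPrime (k : Type*) [Field k] (q r s t : ℕ) :
    Set (Matrix (Fin (q + r + s + (t + r + s))) (Fin (q + r + s + (t + r + s))) k) :=
  {g | (∀ i j : Fin (q + r + s + (t + r + s)), (i : ℕ) < (j : ℕ) → g i j = 0) ∧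
    (∀ i : Fin (q + r + s + (t + r + s)), g i i = 1) ∧
    (∀ i j : Fin (q + r + s + (t + r + s)),
      inBlk (s + r) (q + t) (i : ℕ) → inBlk (s + r) (q + t) (j : ℕ) → (i : ℕ) ≠ (j : ℕ) →
      g i j = 0)}

/-- The maximal torus `T'` of `B'`: diagonal matrices whose first `s+r` diagonal entries
are arbitrary nonzero scalars and whose remaining diagonal entries are `1`. -/
def tPrime (k : Type*) [Field k] (q r s t : ℕ) :
    Set (Matrix (Fin (q + r + s + (t + r + s))) (Fin (q + r + s + (t + r + s))) k) :=
  {g | (∀ i j : Fin (q + r + s + (t + r + s)), (i : ℕ) ≠ (j : ℕ) → g i j = 0) ∧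
    (∀ i : Fin (q + r + s + (t + r + s)), (i : ℕ) < s + r → g i i ≠ 0) ∧
    (∀ i : Fin (q + r + s + (t + r + s)), s + r ≤ (i : ℕ) → g i i = 1)}

/-- The lower triangular unipotent group `U₋`. -/
def uMinus (k : Type*) [Field k] (q r s t : ℕ) :
    Set (Matrix (Fin (q + r + s + (t + r + s))) (Fin (q + r + s + (t + r + s))) k) :=
  {g | (∀ i j : Fin (q + r + s + (t + r + s)), (i : ℕ) < (j : ℕ) → g i j = 0) ∧
    (∀ i : Fin (q + r + s + (t + r + s)), g i i = 1)}

/-- The upper triangular unipotent group `U₊`. -/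
def uPlus (k : Type*) [Field k] (q r s t : ℕ) :
    Set (Matrix (Fin (q + r + s + (t + r + s))) (Fin (q + r + s + (t + r + s))) k) :=
  {g | (∀ i j : Fin (q + r + s + (t + r + s)), (j : ℕ) < (i : ℕ) → g i j = 0) ∧
    (∀ i : Fin (q + r + s + (t + r + s)), g i i = 1)}

/-- The matrix `v₀` (fixed part of `S̃`): block rows `(q, r, s, t, r, s)`, block columns
`(s, s, r, q, t, r)`. -/
def vzero (k : Type*) [Field k] (q r s t : ℕ) :
    Matrix (Fin (q + r + s + (t + r + s))) (Fin (q + r + s + (t + r + s))) k :=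
  Matrix.of fun i j =>
    if Jpos 0 (2 * s + r) q (i : ℕ) (j : ℕ) ∨
       Jpos q (2 * s) r (i : ℕ) (j : ℕ) ∨
       Jpos (q + r) 0 s (i : ℕ) (j : ℕ) ∨
       Ipos (q + r + s) (2 * s + r + q) t (i : ℕ) (j : ℕ) ∨
       Jpos (q + r + s + t) (2 * s) r (i : ℕ) (j : ℕ) ∨
       Ipos (q + r + s + t) (2 * s + r + q + t) r (i : ℕ) (j : ℕ) ∨
       Jpos (q + r + s + t + r) 0 s (i : ℕ) (j : ℕ) ∨
       Ipos (q + r + s + t + r) s s (i : ℕ) (j : ℕ)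
    then 1 else 0

/-- The set `S̃`: matrices of the shape of `v₀` with the blocks `(1,2), (2,2), (4,2),
(5,2)` arbitrary. -/
def sTilde (k : Type*) [Field k] (q r s t : ℕ) :
    Set (Matrix (Fin (q + r + s + (t + r + s))) (Fin (q + r + s + (t + r + s))) k) :=
  {g | ∀ i j : Fin (q + r + s + (t + r + s)),
    ¬ (inBlk s s (j : ℕ) ∧
        (inBlk 0 q (i : ℕ) ∨ inBlk q r (i : ℕ) ∨ inBlk (q + r + s) t (i : ℕ) ∨
          inBlk (q + r + s + t) r (i : ℕ))) →
    g i j = vzero k q r s t i j}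

/-- The group `Q₁` (block rows and columns `(p, q, t, p)`, `p = r+s`): identity except
for an arbitrary `q × t` block in position `(2,3)`. -/
def qOne (k : Type*) [Field k] (q r s t : ℕ) :
    Set (Matrix (Fin (q + r + s + (t + r + s))) (Fin (q + r + s + (t + r + s))) k) :=
  {g | ∀ i j : Fin (q + r + s + (t + r + s)),
    ¬ (inBlk (r + s) q (i : ℕ) ∧ inBlk ((r + s) + q) t (j : ℕ)) →
    g i j = if (i : ℕ) = (j : ℕ) then 1 else 0}

/-- The group `Q₂` (block rows and columns `(p, q, t, p)`, `p = r+s`): identity except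
for an arbitrary `t × q` block in position `(3,2)`. -/
def qTwo (k : Type*) [Field k] (q r s t : ℕ) :
    Set (Matrix (Fin (q + r + s + (t + r + s))) (Fin (q + r + s + (t + r + s))) k) :=
  {g | ∀ i j : Fin (q + r + s + (t + r + s)),
    ¬ (inBlk ((r + s) + q) t (i : ℕ) ∧ inBlk (r + s) q (j : ℕ)) →
    g i j = if (i : ℕ) = (j : ℕ) then 1 else 0}

/-- The subgroup `K = diag(GL(a), GL(b))`, `a = q+r+s`, `b = t+r+s`, as a set of
matrices. -/
def kDiag (k : Type*) [Field k] (q r s t : ℕ) :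
    Set (Matrix (Fin (q + r + s + (t + r + s))) (Fin (q + r + s + (t + r + s))) k) :=
  {g | IsUnit g ∧ ∀ i j : Fin (q + r + s + (t + r + s)),
    (((i : ℕ) < q + r + s ∧ q + r + s ≤ (j : ℕ)) ∨
      (q + r + s ≤ (i : ℕ) ∧ (j : ℕ) < q + r + s)) → g i j = 0}

/-- The parabolic subgroup `P'` of block upper triangular matrices for the partition of
`a+b` into consecutive blocks of sizes `1` (repeated `2s+r` times), `q+t`, and `1`
(repeated `r` times): invertible matrices whose entries strictly below the diagonal
vanish except possibly inside the middle `(q+t) × (q+t)` diagonal square. -/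
def pPrime (k : Type*) [Field k] (q r s t : ℕ) :
    Set (Matrix (Fin (q + r + s + (t + r + s))) (Fin (q + r + s + (t + r + s))) k) :=
  {g | IsUnit g ∧ ∀ i j : Fin (q + r + s + (t + r + s)), (j : ℕ) < (i : ℕ) →
    ¬ (2 * s + r ≤ (j : ℕ) ∧ (i : ℕ) < 2 * s + r + q + t) → g i j = 0}


abbrev Ix (q r s t : ℕ) := Fin (q + r + s + (t + r + s))

def emb {n : ℕ} (off len : ℕ) (h : off + len ≤ n) (i : Fin len) : Fin n := ⟨off + i, by omega⟩

lemma emb_val {n : ℕ} (off len : ℕ) (h : off + len ≤ n) (i : Fin len) :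
    ((emb off len h i : Fin n) : ℕ) = off + i := rfl

lemma sum_six {α : Type*} [AddCommMonoid α] {n : ℕ} (a b c d e f : ℕ)
    (h : a + b + c + d + e + f = n) (F : Fin n → α) :
    ∑ x, F x = ∑ i, F (emb 0 a (by omega) i) + ∑ i, F (emb a b (by omega) i)
      + ∑ i, F (emb (a + b) c (by omega) i) + ∑ i, F (emb (a + b + c) d (by omega) i)
      + ∑ i, F (emb (a + b + c + d) e (by omega) i)
      + ∑ i, F (emb (a + b + c + d + e) f (by omega) i) := by
  subst h
  simp only [Fin.sum_univ_add]
  congr 6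
  funext i
  congr 1
  ext
  simp [emb]

lemma mul_six {k : Type*} [Field k] {n : ℕ} (a b c d e f : ℕ)
    (h : a + b + c + d + e + f = n) (A B : Matrix (Fin n) (Fin n) k)
    {m m' : Type*} (x : m → Fin n) (y : m' → Fin n) :
    (A * B).submatrix x y =
      A.submatrix x (emb 0 a (by omega)) * B.submatrix (emb 0 a (by omega)) y
      + A.submatrix x (emb a b (by omega)) * B.submatrix (emb a b (by omega)) y
      + A.submatrix x (emb (a + b) c (by omega)) * B.submatrix (emb (a + b) c (by omega)) y
      + A.submatrix x (emb (a + b + c) d (by omega)) * B.submatrix (emb (a + b + c) d (by omega)) y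
      + A.submatrix x (emb (a + b + c + d) e (by omega))
        * B.submatrix (emb (a + b + c + d) e (by omega)) y
      + A.submatrix x (emb (a + b + c + d + e) f (by omega))
        * B.submatrix (emb (a + b + c + d + e) f (by omega)) y := by
  ext i j
  simp only [Matrix.submatrix_apply, Matrix.mul_apply, Matrix.add_apply]
  exact sum_six a b c d e f h _

lemma forall_six {n : ℕ} (a b c d e f : ℕ)
    (h : a + b + c + d + e + f = n) (P : Fin n → Prop)
    (h1 : ∀ i, P (emb 0 a (by omega) i)) (h2 : ∀ i, P (emb a b (by omega) i))
    (h3 : ∀ i, P (emb (a + b) c (by omega) i)) (h4 : ∀ i, P (emb (a + b + c) d (by omega) i))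
    (h5 : ∀ i, P (emb (a + b + c + d) e (by omega) i))
    (h6 : ∀ i, P (emb (a + b + c + d + e) f (by omega) i)) : ∀ x, P x := by
  intro x
  have key : ∀ (off len : ℕ) (hl : off + len ≤ n), (∀ i, P (emb off len hl i)) →
      off ≤ (x : ℕ) → (x : ℕ) < off + len → P x := by
    intro off len hl hP h1 h2
    have := hP ⟨x - off, by omega⟩
    have he : emb off len hl ⟨x - off, by omega⟩ = x := by
      ext; simp only [emb]; omega
    rwa [he] at this
  have := x.2
  by_cases k1 : (x : ℕ) < a
  · exact key _ _ _ h1 (by omega) (by omega)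
  by_cases k2 : (x : ℕ) < a + b
  · exact key _ _ _ h2 (by omega) (by omega)
  by_cases k3 : (x : ℕ) < a + b + c
  · exact key _ _ _ h3 (by omega) (by omega)
  by_cases k4 : (x : ℕ) < a + b + c + d
  · exact key _ _ _ h4 (by omega) (by omega)
  by_cases k5 : (x : ℕ) < a + b + c + d + e
  · exact key _ _ _ h5 (by omega) (by omega)
  · exact key _ _ _ h6 (by omega) (by omega)

/-- The permutation underlying `w`. -/
def sigN (q r s t i : ℕ) : ℕ :=
  if i < s then 2 * s - 1 - i
  else if i < s + r then 2 * s + r + q + t + (r - 1 - (i - s))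
  else if i < s + r + q then 2 * s + r + (q - 1 - (i - (s + r)))
  else if i < s + r + q + t then 2 * s + r + q + (i - (s + r + q))
  else if i < s + r + q + t + r then 2 * s + (r - 1 - (i - (s + r + q + t)))
  else s - 1 - (i - (s + r + q + t + r))

def sigF (q r s t : ℕ) (i : Ix q r s t) : Ix q r s t :=
  ⟨sigN q r s t i, by have := i.2; unfold sigN; split_ifs <;> omega⟩

lemma sigF_inj (q r s t : ℕ) : Function.Injective (sigF q r s t) := by
  intro i j h
  have h' : sigN q r s t i = sigN q r s t j := congrArg Fin.val h
  have := i.2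
  have := j.2
  ext
  unfold sigN at h'
  split_ifs at h' <;> omega

noncomputable def sig (q r s t : ℕ) : Ix q r s t ≃ Ix q r s t :=
  Equiv.ofBijective (sigF q r s t) (Finite.injective_iff_bijective.mp (sigF_inj q r s t))

lemma sig_val (q r s t : ℕ) (i : Ix q r s t) : ((sig q r s t i : Ix q r s t) : ℕ) = sigN q r s t i := rfl

lemma wMat_eq (k : Type*) [Field k] (q r s t : ℕ) :
    wMat k q r s t = (1 : Matrix (Ix q r s t) (Ix q r s t) k).submatrix (sig q r s t) id := by
  ext i j
  have hi := i.2
  have hj := j.2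
  simp only [wMat, Matrix.of_apply, Matrix.submatrix_apply, Matrix.one_apply, id]
  refine if_congr ?_ rfl rfl
  rw [Fin.ext_iff, sig_val]
  constructor
  · rintro (h | h | h | h | h | h) <;> obtain ⟨h1, h2, h3⟩ := h <;>
      obtain ⟨h4, h5⟩ := h1 <;> obtain ⟨h6, h7⟩ := h2 <;> unfold sigN <;> split_ifs <;> omega
  · intro h
    unfold sigN at h
    split_ifs at h
    · exact Or.inl (by omega)
    · exact Or.inr (Or.inl (by omega))
    · exact Or.inr (Or.inr (Or.inl (by omega)))
    · exact Or.inr (Or.inr (Or.inr (Or.inl (by omega))))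
    · exact Or.inr (Or.inr (Or.inr (Or.inr (Or.inl (by omega)))))
    · exact Or.inr (Or.inr (Or.inr (Or.inr (Or.inr (by omega)))))

lemma wMat_mul (k : Type*) [Field k] (q r s t : ℕ) (A : Matrix (Ix q r s t) (Ix q r s t) k) :
    wMat k q r s t * A = A.submatrix (sig q r s t) id := by
  rw [wMat_eq]
  ext i j
  simp [Matrix.mul_apply, Matrix.one_apply]

lemma wMat_inv (k : Type*) [Field k] (q r s t : ℕ) :
    (wMat k q r s t)⁻¹ = (1 : Matrix (Ix q r s t) (Ix q r s t) k).submatrix id (sig q r s t) := by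
  apply Matrix.inv_eq_right_inv
  rw [wMat_mul]
  ext i j
  simp [Matrix.one_apply]

lemma wMat_unit (k : Type*) [Field k] (q r s t : ℕ) : (wMat k q r s t)⁻¹ * wMat k q r s t = 1
    ∧ wMat k q r s t * (wMat k q r s t)⁻¹ = 1 := by
  have : wMat k q r s t * (wMat k q r s t)⁻¹ = 1 := by
    rw [wMat_mul, wMat_inv]
    ext i j
    simp [Matrix.one_apply]
  exact ⟨mul_eq_one_comm.mp this, this⟩

lemma mul_wInv (k : Type*) [Field k] (q r s t : ℕ) (A : Matrix (Ix q r s t) (Ix q r s t) k) :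
    A * (wMat k q r s t)⁻¹ = A.submatrix id (sig q r s t) := by
  rw [wMat_inv]
  ext i j
  simp [Matrix.mul_apply, Matrix.one_apply]

lemma conj_apply (k : Type*) [Field k] (q r s t : ℕ) (u : Matrix (Ix q r s t) (Ix q r s t) k)
    (i j) : ((wMat k q r s t)⁻¹ * u * wMat k q r s t) (sig q r s t i) (sig q r s t j) = u i j := by
  have h : wMat k q r s t * ((wMat k q r s t)⁻¹ * u * wMat k q r s t) * (wMat k q r s t)⁻¹ = u := by
    have := (wMat_unit k q r s t).2
    simp only [← mul_assoc, this, one_mul]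
    rw [mul_assoc, this, mul_one]
  rw [mul_wInv, wMat_mul] at h
  conv_rhs => rw [← h]
  rfl

section PartB
variable {k : Type*} [Field k] {q r s t : ℕ}

lemma conj_mem_pPrime (u : Matrix (Ix q r s t) (Ix q r s t) k) (hu : IsUnit u)
    (h : ∀ a b : Ix q r s t, sigN q r s t b < sigN q r s t a →
      ¬ (2 * s + r ≤ sigN q r s t b ∧ sigN q r s t a < 2 * s + r + q + t) → u a b = 0) :
    (wMat k q r s t)⁻¹ * u * wMat k q r s t ∈ pPrime k q r s t := by
  have hw := wMat_unit k q r s t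
  refine ⟨?_, ?_⟩
  · refine IsUnit.mul (IsUnit.mul ?_ hu) ?_
    · exact ⟨⟨_, _, hw.1, hw.2⟩, rfl⟩
    · exact ⟨⟨_, _, hw.2, hw.1⟩, rfl⟩
  · intro i j
    obtain ⟨a, rfl⟩ := (sig q r s t).surjective i
    obtain ⟨b, rfl⟩ := (sig q r s t).surjective j
    rw [conj_apply, sig_val, sig_val]
    exact h a b

lemma isUnit_of_lower (u : Matrix (Ix q r s t) (Ix q r s t) k)
    (h : ∀ i j : Ix q r s t, (i : ℕ) < (j : ℕ) → u i j = 0) (hd : ∀ i, u i i ≠ 0) : IsUnit u := by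
  rw [Matrix.isUnit_iff_isUnit_det, Matrix.det_of_isLowerTriangular, isUnit_iff_ne_zero]
  · exact Finset.prod_ne_zero_iff.mpr fun i _ => hd i
  · intro i j hij
    exact h i j hij

lemma isUnit_of_upper (u : Matrix (Ix q r s t) (Ix q r s t) k)
    (h : ∀ i j : Ix q r s t, (j : ℕ) < (i : ℕ) → u i j = 0) (hd : ∀ i, u i i ≠ 0) : IsUnit u := by
  rw [Matrix.isUnit_iff_isUnit_det, Matrix.det_of_isUpperTriangular, isUnit_iff_ne_zero]
  · exact Finset.prod_ne_zero_iff.mpr fun i _ => hd i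
  · intro i j hij
    exact h i j hij

lemma isUnit_uPrime {u : Matrix (Ix q r s t) (Ix q r s t) k} (h : u ∈ uPrime k q r s t) :
    IsUnit u := isUnit_of_lower u h.1 fun i => by rw [h.2.1 i]; exact one_ne_zero

lemma isUnit_tPrime {u : Matrix (Ix q r s t) (Ix q r s t) k} (h : u ∈ tPrime k q r s t) :
    IsUnit u := isUnit_of_lower u (fun i j hij => h.1 i j hij.ne) fun i => by
  by_cases hi : (i : ℕ) < s + r
  · exact h.2.1 i hi
  · rw [h.2.2 i (by omega)]; exact one_ne_zero

lemma isUnit_qOne {u : Matrix (Ix q r s t) (Ix q r s t) k} (h : u ∈ qOne k q r s t) :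
    IsUnit u := isUnit_of_upper u (fun i j hij => by
      rw [h i j (by rintro ⟨⟨_, _⟩, _, _⟩; omega), if_neg (by omega)]) fun i => by
  rw [h i i (by rintro ⟨⟨_, _⟩, _, _⟩; omega), if_pos rfl]; exact one_ne_zero

lemma isUnit_qTwo {u : Matrix (Ix q r s t) (Ix q r s t) k} (h : u ∈ qTwo k q r s t) :
    IsUnit u := isUnit_of_lower u (fun i j hij => by
      rw [h i j (by rintro ⟨⟨_, _⟩, _, _⟩; omega), if_neg (by omega)]) fun i => by
  rw [h i i (by rintro ⟨⟨_, _⟩, _, _⟩; omega), if_pos rfl]; exact one_ne_zero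

/-- Elements of `U'_{+,w}` vanish where `sig` is increasing the wrong way. -/
lemma uPlus_conj_zero {u : Matrix (Ix q r s t) (Ix q r s t) k}
    (h : u ∈ (fun u => wMat k q r s t * u * (wMat k q r s t)⁻¹) '' uPlus k q r s t)
    (a b : Ix q r s t) (hab : sigN q r s t b < sigN q r s t a) : u a b = 0 := by
  obtain ⟨v, hv, rfl⟩ := h
  simp only
  rw [mul_wInv, wMat_mul]
  exact hv.1 _ _ hab

lemma partA1 {u : Matrix (Ix q r s t) (Ix q r s t) k} (h : u ∈ uPrime k q r s t)
    (h' : u ∈ (fun u => wMat k q r s t * u * (wMat k q r s t)⁻¹) '' uPlus k q r s t) :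
    (wMat k q r s t)⁻¹ * u * wMat k q r s t ∈ pPrime k q r s t :=
  conj_mem_pPrime u (isUnit_uPrime h) fun a b hab _ => uPlus_conj_zero h' a b hab

lemma partA2 {u : Matrix (Ix q r s t) (Ix q r s t) k} (h : u ∈ tPrime k q r s t) :
    (wMat k q r s t)⁻¹ * u * wMat k q r s t ∈ pPrime k q r s t :=
  conj_mem_pPrime u (isUnit_tPrime h) fun a b hab _ => h.1 a b fun e => by
    rw [e] at hab; omega

lemma partA3 {u : Matrix (Ix q r s t) (Ix q r s t) k} (h : u ∈ qOne k q r s t) :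
    (wMat k q r s t)⁻¹ * u * wMat k q r s t ∈ pPrime k q r s t :=
  conj_mem_pPrime u (isUnit_qOne h) fun a b hab hn => by
    rw [h a b, if_neg]
    · intro e
      rw [e] at hab; omega
    · rintro ⟨⟨h1, h2⟩, h3, h4⟩
      unfold sigN at hab hn
      split_ifs at hab hn <;> omega

lemma partA4 {u : Matrix (Ix q r s t) (Ix q r s t) k} (h : u ∈ qTwo k q r s t) :
    (wMat k q r s t)⁻¹ * u * wMat k q r s t ∈ pPrime k q r s t :=
  conj_mem_pPrime u (isUnit_qTwo h) fun a b hab hn => by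
    rw [h a b, if_neg]
    · intro e
      rw [e] at hab; omega
    · rintro ⟨⟨h1, h2⟩, h3, h4⟩
      unfold sigN at hab hn
      split_ifs at hab hn <;> omega

lemma bt_inv {n α : Type*} [Fintype n] [DecidableEq n] [LinearOrder α] {M : Matrix n n k}
    {b : n → α} (hu : IsUnit M) (h : M.BlockTriangular b) : (M⁻¹).BlockTriangular b := by
  have := hu.invertible
  exact Matrix.blockTriangular_inv_of_blockTriangular h

lemma isUnit_inv' {n : Type*} [Fintype n] [DecidableEq n] {M : Matrix n n k} (hu : IsUnit M) :
    IsUnit M⁻¹ ∧ M * M⁻¹ = 1 ∧ M⁻¹ * M = 1 := by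
  have hd := (Matrix.isUnit_iff_isUnit_det M).mp hu
  have h1 := Matrix.mul_nonsing_inv M hd
  have h2 := Matrix.nonsing_inv_mul M hd
  exact ⟨⟨⟨_, _, h2, h1⟩, rfl⟩, h1, h2⟩

lemma pPrime_inv {M : Matrix (Ix q r s t) (Ix q r s t) k} (h : M ∈ pPrime k q r s t) :
    M⁻¹ ∈ pPrime k q r s t := by
  obtain ⟨hu, h⟩ := h
  refine ⟨(isUnit_inv' hu).1, ?_⟩
  have hb : M.BlockTriangular (fun i : Ix q r s t => if (i : ℕ) < 2 * s + r then (i : ℕ)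
      else if (i : ℕ) < 2 * s + r + q + t then 2 * s + r else (i : ℕ)) := by
    intro i j hij
    dsimp only at hij
    apply h i j <;> split_ifs at hij <;> omega
  intro i j hij hn
  apply bt_inv hu hb
  dsimp only
  split_ifs <;> omega

lemma kDiag_inv {M : Matrix (Ix q r s t) (Ix q r s t) k} (h : M ∈ kDiag k q r s t) :
    M⁻¹ ∈ kDiag k q r s t := by
  obtain ⟨hu, h⟩ := h
  refine ⟨(isUnit_inv' hu).1, ?_⟩
  have hb : M.BlockTriangular (fun i : Ix q r s t => if (i : ℕ) < q + r + s then 0 else 1) := by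
    intro i j hij
    dsimp only at hij
    apply h i j; split_ifs at hij <;> omega
  have hb' : M.BlockTriangular (fun i : Ix q r s t => if (i : ℕ) < q + r + s then 1 else 0) := by
    intro i j hij
    dsimp only at hij
    apply h i j; split_ifs at hij <;> omega
  rintro i j (hij | hij)
  · apply bt_inv hu hb'
    dsimp only
    split_ifs <;> omega
  · apply bt_inv hu hb
    dsimp only
    split_ifs <;> omega

lemma one_mem_kDiag : (1 : Matrix (Ix q r s t) (Ix q r s t) k) ∈ kDiag k q r s t := by
  refine ⟨isUnit_one, fun i j h => Matrix.one_apply_ne ?_⟩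
  rintro rfl
  omega

lemma one_mem_pPrime : (1 : Matrix (Ix q r s t) (Ix q r s t) k) ∈ pPrime k q r s t := by
  refine ⟨isUnit_one, fun i j h _ => Matrix.one_apply_ne ?_⟩
  rintro rfl
  omega

/-- First grading: lower triangular with a middle block. -/
def gr1 (q r s t : ℕ) (i : Ix q r s t) : ℕᵒᵈ := OrderDual.toDual
  (if (i : ℕ) < s + r then (i : ℕ) else if (i : ℕ) < s + r + q + t then s + r else (i : ℕ))

/-- Second grading. -/
def gr2 (q r s t : ℕ) (i : Ix q r s t) : ℕ :=
  if s ≤ (i : ℕ) ∧ (i : ℕ) < s + r + q + t + r then 1 else 0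

def Pat (M : Matrix (Ix q r s t) (Ix q r s t) k) : Prop :=
  M.BlockTriangular (gr1 q r s t) ∧ M.BlockTriangular (gr2 q r s t)

lemma Pat.mul {M N : Matrix (Ix q r s t) (Ix q r s t) k} (hM : Pat M) (hN : Pat N) : Pat (M * N) :=
  ⟨hM.1.mul hN.1, hM.2.mul hN.2⟩

lemma Pat.inv {M : Matrix (Ix q r s t) (Ix q r s t) k} (hM : Pat M) (hu : IsUnit M) : Pat M⁻¹ :=
  ⟨bt_inv hu hM.1, bt_inv hu hM.2⟩

lemma Pat.z1 {M : Matrix (Ix q r s t) (Ix q r s t) k} (hM : Pat M) (i j : Ix q r s t)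
    (hij : (i : ℕ) < j) (h : (i : ℕ) < s + r ∨ s + r + q + t ≤ (j : ℕ)) : M i j = 0 := by
  apply hM.1
  simp only [gr1, OrderDual.toDual_lt_toDual]
  split_ifs <;> omega

lemma Pat.z2 {M : Matrix (Ix q r s t) (Ix q r s t) k} (hM : Pat M) (i j : Ix q r s t)
    (hi : s ≤ (i : ℕ) ∧ (i : ℕ) < s + r + q + t + r) (hj : (j : ℕ) < s) : M i j = 0 := by
  apply hM.2
  simp only [gr2]
  rw [if_pos hi, if_neg (by omega)]; omega

lemma Pat.of {M : Matrix (Ix q r s t) (Ix q r s t) k}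
    (h1 : ∀ i j : Ix q r s t, (i : ℕ) < j → ((i : ℕ) < s + r ∨ s + r + q + t ≤ (j : ℕ)) → M i j = 0)
    (h2 : ∀ i j : Ix q r s t, (s ≤ (i : ℕ) ∧ (i : ℕ) < s + r + q + t + r) → (j : ℕ) < s → M i j = 0) :
    Pat M := by
  constructor
  · intro i j hij
    simp only [gr1, OrderDual.toDual_lt_toDual] at hij
    apply h1 <;> split_ifs at hij <;> omega
  · intro i j hij
    simp only [gr2] at hij
    by_cases hj : (j : ℕ) < s
    · apply h2 _ _ _ hj
      split_ifs at hij <;> omega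
    · apply h1 <;> split_ifs at hij <;> omega

lemma pat_u {u : Matrix (Ix q r s t) (Ix q r s t) k} (h : u ∈ uPrime k q r s t)
    (h' : u ∈ (fun u => wMat k q r s t * u * (wMat k q r s t)⁻¹) '' uPlus k q r s t) : Pat u := by
  refine Pat.of (fun i j hij _ => h.1 i j hij) fun i j hi hj => uPlus_conj_zero h' i j ?_
  unfold sigN
  split_ifs <;> omega

lemma pat_t {u : Matrix (Ix q r s t) (Ix q r s t) k} (h : u ∈ tPrime k q r s t) : Pat u :=
  Pat.of (fun i j hij _ => h.1 i j hij.ne) fun i j hi hj => h.1 i j (by omega)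

lemma pat_q1 {u : Matrix (Ix q r s t) (Ix q r s t) k} (h : u ∈ qOne k q r s t) : Pat u :=
  Pat.of (fun i j hij h1 => by
    rw [h i j (by rintro ⟨⟨_, _⟩, _, _⟩; omega), if_neg (by omega)]) fun i j hi hj => by
    rw [h i j (by rintro ⟨⟨_, _⟩, _, _⟩; omega), if_neg (by omega)]

lemma pat_q2 {u : Matrix (Ix q r s t) (Ix q r s t) k} (h : u ∈ qTwo k q r s t) : Pat u :=
  Pat.of (fun i j hij h1 => by
    rw [h i j (by rintro ⟨⟨_, _⟩, _, _⟩; omega), if_neg (by omega)]) fun i j hi hj => by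
    rw [h i j (by rintro ⟨⟨_, _⟩, _, _⟩; omega), if_neg (by omega)]

lemma diag_mul {A B : Matrix (Ix q r s t) (Ix q r s t) k} (hA : Pat A) (hB : Pat B)
    (i : Ix q r s t) (hi : (i : ℕ) < s + r ∨ s + r + q + t ≤ (i : ℕ)) :
    (A * B) i i = A i i * B i i := by
  rw [Matrix.mul_apply]
  refine Finset.sum_eq_single i (fun j _ hj => ?_) (by simp)
  have hj' : (j : ℕ) ≠ i := fun e => hj (Fin.ext e)
  rcases lt_or_gt_of_ne hj' with hlt | hlt
  · rw [hB.z1 j i hlt (by omega), mul_zero]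
  · rw [hA.z1 i j hlt (by omega), zero_mul]

lemma mid_mul {A B : Matrix (Ix q r s t) (Ix q r s t) k} (hA : Pat A) (hB : Pat B)
    {m m' : Type*} (x : m → Ix q r s t) (y : m' → Ix q r s t)
    (hx : ∀ i, inBlk (s + r) (q + t) (x i : ℕ)) (hy : ∀ i, inBlk (s + r) (q + t) (y i : ℕ)) :
    (A * B).submatrix x y =
      A.submatrix x (emb (s + r) q (by omega)) * B.submatrix (emb (s + r) q (by omega)) y
      + A.submatrix x (emb (s + r + q) t (by omega)) * B.submatrix (emb (s + r + q) t (by omega)) y := by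
  rw [mul_six s r q t r s (by omega)]
  have z1 : B.submatrix (emb 0 s (by omega)) y = 0 := by
    ext i j
    have := hy j
    exact hB.z1 _ _ (by rw [emb_val]; omega) (by rw [emb_val]; omega)
  have z2 : B.submatrix (emb s r (by omega)) y = 0 := by
    ext i j
    have := hy j
    exact hB.z1 _ _ (by rw [emb_val]; omega) (by rw [emb_val]; omega)
  have z5 : A.submatrix x (emb (s + r + q + t) r (by omega)) = 0 := by
    ext i j
    have := hx i
    exact hA.z1 _ _ (by rw [emb_val]; omega) (by rw [emb_val]; omega)
  have z6 : A.submatrix x (emb (s + r + q + t + r) s (by omega)) = 0 := by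
    ext i j
    have := hx i
    exact hA.z1 _ _ (by rw [emb_val]; omega) (by rw [emb_val]; omega)
  rw [z1, z2, z5, z6]
  simp
end PartB

def c1 {q r s t : ℕ} : Fin s → Ix q r s t := emb (0) s (by omega)
def c2 {q r s t : ℕ} : Fin r → Ix q r s t := emb (s) r (by omega)
def c3 {q r s t : ℕ} : Fin q → Ix q r s t := emb (s + r) q (by omega)
def c4 {q r s t : ℕ} : Fin t → Ix q r s t := emb (s + r + q) t (by omega)
def c5 {q r s t : ℕ} : Fin r → Ix q r s t := emb (s + r + q + t) r (by omega)
def c6 {q r s t : ℕ} : Fin s → Ix q r s t := emb (s + r + q + t + r) s (by omega)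
def r1 {q r s t : ℕ} : Fin q → Ix q r s t := emb (0) q (by omega)
def r2 {q r s t : ℕ} : Fin r → Ix q r s t := emb (q) r (by omega)
def r3 {q r s t : ℕ} : Fin s → Ix q r s t := emb (q + r) s (by omega)
def r4 {q r s t : ℕ} : Fin t → Ix q r s t := emb (q + r + s) t (by omega)
def r5 {q r s t : ℕ} : Fin r → Ix q r s t := emb (q + r + s + t) r (by omega)
def r6 {q r s t : ℕ} : Fin s → Ix q r s t := emb (q + r + s + t + r) s (by omega)

section PartC
variable {k : Type*} [Field k] {q r s t : ℕ}

lemma c1_val (i : Fin s) : (((c1 i : Ix q r s t)) : ℕ) = 0 + i := rfl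
lemma c2_val (i : Fin r) : (((c2 i : Ix q r s t)) : ℕ) = s + i := rfl
lemma c3_val (i : Fin q) : (((c3 i : Ix q r s t)) : ℕ) = s + r + i := rfl
lemma c4_val (i : Fin t) : (((c4 i : Ix q r s t)) : ℕ) = s + r + q + i := rfl
lemma c5_val (i : Fin r) : (((c5 i : Ix q r s t)) : ℕ) = s + r + q + t + i := rfl
lemma c6_val (i : Fin s) : (((c6 i : Ix q r s t)) : ℕ) = s + r + q + t + r + i := rfl
lemma r1_val (i : Fin q) : (((r1 i : Ix q r s t)) : ℕ) = 0 + i := rfl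
lemma r2_val (i : Fin r) : (((r2 i : Ix q r s t)) : ℕ) = q + i := rfl
lemma r3_val (i : Fin s) : (((r3 i : Ix q r s t)) : ℕ) = q + r + i := rfl
lemma r4_val (i : Fin t) : (((r4 i : Ix q r s t)) : ℕ) = q + r + s + i := rfl
lemma r5_val (i : Fin r) : (((r5 i : Ix q r s t)) : ℕ) = q + r + s + t + i := rfl
lemma r6_val (i : Fin s) : (((r6 i : Ix q r s t)) : ℕ) = q + r + s + t + r + i := rfl
lemma sig_c1 (i : Fin s) : ((sig q r s t (c1 i) : Ix q r s t) : ℕ) = s + (s - 1 - i) := by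
  have := i.2
  rw [sig_val, c1_val]
  unfold sigN
  split_ifs <;> omega
lemma sig_c2 (i : Fin r) : ((sig q r s t (c2 i) : Ix q r s t) : ℕ) = 2 * s + r + q + t + (r - 1 - i) := by
  have := i.2
  rw [sig_val, c2_val]
  unfold sigN
  split_ifs <;> omega
lemma sig_c3 (i : Fin q) : ((sig q r s t (c3 i) : Ix q r s t) : ℕ) = 2 * s + r + (q - 1 - i) := by
  have := i.2
  rw [sig_val, c3_val]
  unfold sigN
  split_ifs <;> omega
lemma sig_c4 (i : Fin t) : ((sig q r s t (c4 i) : Ix q r s t) : ℕ) = 2 * s + r + q + i := by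
  have := i.2
  rw [sig_val, c4_val]
  unfold sigN
  split_ifs <;> omega
lemma sig_c5 (i : Fin r) : ((sig q r s t (c5 i) : Ix q r s t) : ℕ) = 2 * s + (r - 1 - i) := by
  have := i.2
  rw [sig_val, c5_val]
  unfold sigN
  split_ifs <;> omega
lemma sig_c6 (i : Fin s) : ((sig q r s t (c6 i) : Ix q r s t) : ℕ) = s - 1 - i := by
  have := i.2
  rw [sig_val, c6_val]
  unfold sigN
  split_ifs <;> omega

lemma mul_c (A B : Matrix (Ix q r s t) (Ix q r s t) k) {m m' : Type*}
    (x : m → Ix q r s t) (y : m' → Ix q r s t) :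
    (A * B).submatrix x y = A.submatrix x c1 * B.submatrix c1 y
      + A.submatrix x c2 * B.submatrix c2 y
      + A.submatrix x c3 * B.submatrix c3 y
      + A.submatrix x c4 * B.submatrix c4 y
      + A.submatrix x c5 * B.submatrix c5 y
      + A.submatrix x c6 * B.submatrix c6 y :=
  mul_six s r q t r s (by omega) A B x y

lemma mul_r (A B : Matrix (Ix q r s t) (Ix q r s t) k) {m m' : Type*}
    (x : m → Ix q r s t) (y : m' → Ix q r s t) :
    (A * B).submatrix x y = A.submatrix x r1 * B.submatrix r1 y
      + A.submatrix x r2 * B.submatrix r2 y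
      + A.submatrix x r3 * B.submatrix r3 y
      + A.submatrix x r4 * B.submatrix r4 y
      + A.submatrix x r5 * B.submatrix r5 y
      + A.submatrix x r6 * B.submatrix r6 y :=
  mul_six q r s t r s (by omega) A B x y

def Jm (k : Type*) [Field k] (n : ℕ) : Matrix (Fin n) (Fin n) k :=
  Matrix.of fun i j => if (i : ℕ) + (j : ℕ) = n - 1 then 1 else 0

lemma Jm_eq (n : ℕ) : Jm k n = (1 : Matrix (Fin n) (Fin n) k).submatrix Fin.rev id := by
  ext i j
  simp only [Jm, Matrix.of_apply, Matrix.submatrix_apply, Matrix.one_apply, id]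
  refine if_congr ?_ rfl rfl
  rw [Fin.ext_iff, Fin.val_rev]
  omega

lemma Jm_mul_apply {n : ℕ} (A : Matrix (Fin n) (Fin n) k) (i j : Fin n) :
    (Jm k n * A) i j = A (Fin.rev i) j := by
  rw [Jm_eq]
  simp [Matrix.mul_apply, Matrix.one_apply]

lemma mul_Jm_apply {m n : ℕ} (A : Matrix (Fin m) (Fin n) k) (i : Fin m) (j : Fin n) :
    (A * Jm k n) i j = A i (Fin.rev j) := by
  rw [Jm_eq]
  simp [Matrix.mul_apply, Matrix.one_apply, Fin.rev_eq_iff]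

/-- A lower triangular matrix conjugate by `J` to a lower unitriangular one is `1`. -/
lemma rigid {n : ℕ} (A B : Matrix (Fin n) (Fin n) k) (hA : ∀ i j, i < j → A i j = 0)
    (hB : ∀ i j, i < j → B i j = 0) (hB1 : ∀ i, B i i = 1) (h : Jm k n * A = B * Jm k n) :
    A = 1 ∧ B = 1 := by
  have e : ∀ i j, A (Fin.rev i) (Fin.rev j) = B i j := by
    intro i j
    have := congrFun (congrFun h i) (Fin.rev j)
    rwa [Jm_mul_apply, mul_Jm_apply, Fin.rev_rev] at this
  have hB' : B = 1 := by
    ext i j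
    rcases lt_trichotomy i j with hij | rfl | hij
    · rw [hB i j hij, Matrix.one_apply_ne hij.ne]
    · rw [hB1, Matrix.one_apply_eq]
    · rw [← e, hA _ _ (Fin.rev_lt_rev.mpr hij), Matrix.one_apply_ne hij.ne']
  refine ⟨?_, hB'⟩
  ext i j
  have := e (Fin.rev i) (Fin.rev j)
  rw [Fin.rev_rev, Fin.rev_rev, hB'] at this
  rw [this, Matrix.one_apply, Matrix.one_apply]
  simp [Fin.rev_inj]

lemma hblk {g : Matrix (Ix q r s t) (Ix q r s t) k} (hg : g ∈ sTilde k q r s t) (i j : Ix q r s t)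
    (h : ¬ (((j : ℕ) < s) ∧ ((i : ℕ) < q + r ∨ inBlk (q + r + s) (t + r) (i : ℕ)))) :
    (g.submatrix id (sig q r s t)) i j = vzero k q r s t i (sig q r s t j) := by
  refine hg i _ fun h' => h ?_
  rw [sig_val] at h'
  obtain ⟨h1, h2⟩ := h'
  have hj := j.2
  have : (j : ℕ) < s := by
    unfold sigN inBlk at h1
    split_ifs at h1 <;> omega
  refine ⟨this, ?_⟩
  omega

/-- The block shape of `g w⁻¹` for `g` in `S̃`. -/
structure HB (h : Matrix (Ix q r s t) (Ix q r s t) k) : Prop where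
  h12 : h.submatrix r1 c2 = 0
  h13 : h.submatrix r1 c3 = 1
  h14 : h.submatrix r1 c4 = 0
  h15 : h.submatrix r1 c5 = 0
  h16 : h.submatrix r1 c6 = 0
  h22 : h.submatrix r2 c2 = 0
  h23 : h.submatrix r2 c3 = 0
  h24 : h.submatrix r2 c4 = 0
  h25 : h.submatrix r2 c5 = 1
  h26 : h.submatrix r2 c6 = 0
  h31 : h.submatrix r3 c1 = 0
  h32 : h.submatrix r3 c2 = 0
  h33 : h.submatrix r3 c3 = 0
  h34 : h.submatrix r3 c4 = 0
  h35 : h.submatrix r3 c5 = 0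
  h36 : h.submatrix r3 c6 = 1
  h42 : h.submatrix r4 c2 = 0
  h43 : h.submatrix r4 c3 = 0
  h44 : h.submatrix r4 c4 = 1
  h45 : h.submatrix r4 c5 = 0
  h46 : h.submatrix r4 c6 = 0
  h52 : h.submatrix r5 c2 = Jm k r
  h53 : h.submatrix r5 c3 = 0
  h54 : h.submatrix r5 c4 = 0
  h55 : h.submatrix r5 c5 = 1
  h56 : h.submatrix r5 c6 = 0
  h61 : h.submatrix r6 c1 = Jm k s
  h62 : h.submatrix r6 c2 = 0
  h63 : h.submatrix r6 c3 = 0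
  h64 : h.submatrix r6 c4 = 0
  h65 : h.submatrix r6 c5 = 0
  h66 : h.submatrix r6 c6 = 1

lemma HB.of {g : Matrix (Ix q r s t) (Ix q r s t) k} (hg : g ∈ sTilde k q r s t) :
    HB (g.submatrix id (sig q r s t)) := by
  constructor
  · ext i j
    have hi := i.2; have hj := j.2
    rw [Matrix.submatrix_apply, hblk hg _ _ (by rw [r1_val, c2_val]; omega)]
    simp only [vzero, Matrix.of_apply, r1_val, sig_c2]
    exact if_neg (by omega)
  · ext i j
    have hi := i.2; have hj := j.2
    rw [Matrix.submatrix_apply, hblk hg _ _ (by rw [r1_val, c3_val]; omega)]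
    simp only [vzero, Matrix.of_apply, r1_val, sig_c3]
    simp only [Matrix.one_apply, Fin.ext_iff]
    refine if_congr ⟨fun h => by omega, fun h => ?_⟩ rfl rfl
    exact Or.inl (by omega)
  · ext i j
    have hi := i.2; have hj := j.2
    rw [Matrix.submatrix_apply, hblk hg _ _ (by rw [r1_val, c4_val]; omega)]
    simp only [vzero, Matrix.of_apply, r1_val, sig_c4]
    exact if_neg (by omega)
  · ext i j
    have hi := i.2; have hj := j.2
    rw [Matrix.submatrix_apply, hblk hg _ _ (by rw [r1_val, c5_val]; omega)]
    simp only [vzero, Matrix.of_apply, r1_val, sig_c5]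
    exact if_neg (by omega)
  · ext i j
    have hi := i.2; have hj := j.2
    rw [Matrix.submatrix_apply, hblk hg _ _ (by rw [r1_val, c6_val]; omega)]
    simp only [vzero, Matrix.of_apply, r1_val, sig_c6]
    exact if_neg (by omega)
  · ext i j
    have hi := i.2; have hj := j.2
    rw [Matrix.submatrix_apply, hblk hg _ _ (by rw [r2_val, c2_val]; omega)]
    simp only [vzero, Matrix.of_apply, r2_val, sig_c2]
    exact if_neg (by omega)
  · ext i j
    have hi := i.2; have hj := j.2
    rw [Matrix.submatrix_apply, hblk hg _ _ (by rw [r2_val, c3_val]; omega)]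
    simp only [vzero, Matrix.of_apply, r2_val, sig_c3]
    exact if_neg (by omega)
  · ext i j
    have hi := i.2; have hj := j.2
    rw [Matrix.submatrix_apply, hblk hg _ _ (by rw [r2_val, c4_val]; omega)]
    simp only [vzero, Matrix.of_apply, r2_val, sig_c4]
    exact if_neg (by omega)
  · ext i j
    have hi := i.2; have hj := j.2
    rw [Matrix.submatrix_apply, hblk hg _ _ (by rw [r2_val, c5_val]; omega)]
    simp only [vzero, Matrix.of_apply, r2_val, sig_c5]
    simp only [Matrix.one_apply, Fin.ext_iff]
    refine if_congr ⟨fun h => by omega, fun h => ?_⟩ rfl rfl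
    exact Or.inr (Or.inl (by omega))
  · ext i j
    have hi := i.2; have hj := j.2
    rw [Matrix.submatrix_apply, hblk hg _ _ (by rw [r2_val, c6_val]; omega)]
    simp only [vzero, Matrix.of_apply, r2_val, sig_c6]
    exact if_neg (by omega)
  · ext i j
    have hi := i.2; have hj := j.2
    rw [Matrix.submatrix_apply, hblk hg _ _ (by rw [r3_val, c1_val]; omega)]
    simp only [vzero, Matrix.of_apply, r3_val, sig_c1]
    exact if_neg (by omega)
  · ext i j
    have hi := i.2; have hj := j.2
    rw [Matrix.submatrix_apply, hblk hg _ _ (by rw [r3_val, c2_val]; omega)]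
    simp only [vzero, Matrix.of_apply, r3_val, sig_c2]
    exact if_neg (by omega)
  · ext i j
    have hi := i.2; have hj := j.2
    rw [Matrix.submatrix_apply, hblk hg _ _ (by rw [r3_val, c3_val]; omega)]
    simp only [vzero, Matrix.of_apply, r3_val, sig_c3]
    exact if_neg (by omega)
  · ext i j
    have hi := i.2; have hj := j.2
    rw [Matrix.submatrix_apply, hblk hg _ _ (by rw [r3_val, c4_val]; omega)]
    simp only [vzero, Matrix.of_apply, r3_val, sig_c4]
    exact if_neg (by omega)
  · ext i j
    have hi := i.2; have hj := j.2
    rw [Matrix.submatrix_apply, hblk hg _ _ (by rw [r3_val, c5_val]; omega)]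
    simp only [vzero, Matrix.of_apply, r3_val, sig_c5]
    exact if_neg (by omega)
  · ext i j
    have hi := i.2; have hj := j.2
    rw [Matrix.submatrix_apply, hblk hg _ _ (by rw [r3_val, c6_val]; omega)]
    simp only [vzero, Matrix.of_apply, r3_val, sig_c6]
    simp only [Matrix.one_apply, Fin.ext_iff]
    refine if_congr ⟨fun h => by omega, fun h => ?_⟩ rfl rfl
    exact Or.inr (Or.inr (Or.inl (by omega)))
  · ext i j
    have hi := i.2; have hj := j.2
    rw [Matrix.submatrix_apply, hblk hg _ _ (by rw [r4_val, c2_val]; omega)]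
    simp only [vzero, Matrix.of_apply, r4_val, sig_c2]
    exact if_neg (by omega)
  · ext i j
    have hi := i.2; have hj := j.2
    rw [Matrix.submatrix_apply, hblk hg _ _ (by rw [r4_val, c3_val]; omega)]
    simp only [vzero, Matrix.of_apply, r4_val, sig_c3]
    exact if_neg (by omega)
  · ext i j
    have hi := i.2; have hj := j.2
    rw [Matrix.submatrix_apply, hblk hg _ _ (by rw [r4_val, c4_val]; omega)]
    simp only [vzero, Matrix.of_apply, r4_val, sig_c4]
    simp only [Matrix.one_apply, Fin.ext_iff]
    refine if_congr ⟨fun h => by omega, fun h => ?_⟩ rfl rfl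
    exact Or.inr (Or.inr (Or.inr (Or.inl (by omega))))
  · ext i j
    have hi := i.2; have hj := j.2
    rw [Matrix.submatrix_apply, hblk hg _ _ (by rw [r4_val, c5_val]; omega)]
    simp only [vzero, Matrix.of_apply, r4_val, sig_c5]
    exact if_neg (by omega)
  · ext i j
    have hi := i.2; have hj := j.2
    rw [Matrix.submatrix_apply, hblk hg _ _ (by rw [r4_val, c6_val]; omega)]
    simp only [vzero, Matrix.of_apply, r4_val, sig_c6]
    exact if_neg (by omega)
  · ext i j
    have hi := i.2; have hj := j.2
    rw [Matrix.submatrix_apply, hblk hg _ _ (by rw [r5_val, c2_val]; omega)]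
    simp only [vzero, Matrix.of_apply, r5_val, sig_c2]
    simp only [Jm, Matrix.of_apply]
    refine if_congr ⟨fun h => by omega, fun h => ?_⟩ rfl rfl
    exact Or.inr (Or.inr (Or.inr (Or.inr (Or.inr (Or.inl (by omega))))))
  · ext i j
    have hi := i.2; have hj := j.2
    rw [Matrix.submatrix_apply, hblk hg _ _ (by rw [r5_val, c3_val]; omega)]
    simp only [vzero, Matrix.of_apply, r5_val, sig_c3]
    exact if_neg (by omega)
  · ext i j
    have hi := i.2; have hj := j.2
    rw [Matrix.submatrix_apply, hblk hg _ _ (by rw [r5_val, c4_val]; omega)]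
    simp only [vzero, Matrix.of_apply, r5_val, sig_c4]
    exact if_neg (by omega)
  · ext i j
    have hi := i.2; have hj := j.2
    rw [Matrix.submatrix_apply, hblk hg _ _ (by rw [r5_val, c5_val]; omega)]
    simp only [vzero, Matrix.of_apply, r5_val, sig_c5]
    simp only [Matrix.one_apply, Fin.ext_iff]
    refine if_congr ⟨fun h => by omega, fun h => ?_⟩ rfl rfl
    exact Or.inr (Or.inr (Or.inr (Or.inr (Or.inl (by omega)))))
  · ext i j
    have hi := i.2; have hj := j.2
    rw [Matrix.submatrix_apply, hblk hg _ _ (by rw [r5_val, c6_val]; omega)]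
    simp only [vzero, Matrix.of_apply, r5_val, sig_c6]
    exact if_neg (by omega)
  · ext i j
    have hi := i.2; have hj := j.2
    rw [Matrix.submatrix_apply, hblk hg _ _ (by rw [r6_val, c1_val]; omega)]
    simp only [vzero, Matrix.of_apply, r6_val, sig_c1]
    simp only [Jm, Matrix.of_apply]
    refine if_congr ⟨fun h => by omega, fun h => ?_⟩ rfl rfl
    exact Or.inr (Or.inr (Or.inr (Or.inr (Or.inr (Or.inr (Or.inr ((by omega))))))))
  · ext i j
    have hi := i.2; have hj := j.2
    rw [Matrix.submatrix_apply, hblk hg _ _ (by rw [r6_val, c2_val]; omega)]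
    simp only [vzero, Matrix.of_apply, r6_val, sig_c2]
    exact if_neg (by omega)
  · ext i j
    have hi := i.2; have hj := j.2
    rw [Matrix.submatrix_apply, hblk hg _ _ (by rw [r6_val, c3_val]; omega)]
    simp only [vzero, Matrix.of_apply, r6_val, sig_c3]
    exact if_neg (by omega)
  · ext i j
    have hi := i.2; have hj := j.2
    rw [Matrix.submatrix_apply, hblk hg _ _ (by rw [r6_val, c4_val]; omega)]
    simp only [vzero, Matrix.of_apply, r6_val, sig_c4]
    exact if_neg (by omega)
  · ext i j
    have hi := i.2; have hj := j.2
    rw [Matrix.submatrix_apply, hblk hg _ _ (by rw [r6_val, c5_val]; omega)]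
    simp only [vzero, Matrix.of_apply, r6_val, sig_c5]
    exact if_neg (by omega)
  · ext i j
    have hi := i.2; have hj := j.2
    rw [Matrix.submatrix_apply, hblk hg _ _ (by rw [r6_val, c6_val]; omega)]
    simp only [vzero, Matrix.of_apply, r6_val, sig_c6]
    simp only [Matrix.one_apply, Fin.ext_iff]
    refine if_congr ⟨fun h => by omega, fun h => ?_⟩ rfl rfl
    exact Or.inr (Or.inr (Or.inr (Or.inr (Or.inr (Or.inr (Or.inl (by omega)))))))
end PartC

set_option linter.unusedSimpArgs false
section PartD
variable {k : Type*} [Field k] {q r s t : ℕ}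

lemma Jm_sq (n : ℕ) : Jm k n * Jm k n = 1 := by
  ext i j
  rw [Jm_mul_apply, Jm_eq, Matrix.submatrix_apply, Fin.rev_rev, id]

lemma Pat.sub1 {Y : Matrix (Ix q r s t) (Ix q r s t) k} (hY : Pat Y) {m m' : Type*}
    (x : m → Ix q r s t) (y : m' → Ix q r s t)
    (h : ∀ i j, (x i : ℕ) < y j ∧ ((x i : ℕ) < s + r ∨ s + r + q + t ≤ (y j : ℕ))) :
    Y.submatrix x y = 0 := by
  ext i j
  exact hY.z1 _ _ (h i j).1 (h i j).2

lemma Pat.sub2 {Y : Matrix (Ix q r s t) (Ix q r s t) k} (hY : Pat Y) {m : Type*}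
    (x : m → Ix q r s t) (h : ∀ i, s ≤ (x i : ℕ) ∧ (x i : ℕ) < s + r + q + t + r) :
    Y.submatrix x c1 = 0 := by
  ext i j
  exact hY.z2 _ _ (h i) (by rw [c1_val]; omega)

/-- The zero blocks of a matrix with the pattern `Pat`. -/
structure YZ (Y : Matrix (Ix q r s t) (Ix q r s t) k) : Prop where
  y12 : Y.submatrix c1 c2 = 0
  y13 : Y.submatrix c1 c3 = 0
  y14 : Y.submatrix c1 c4 = 0
  y15 : Y.submatrix c1 c5 = 0
  y16 : Y.submatrix c1 c6 = 0
  y23 : Y.submatrix c2 c3 = 0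
  y24 : Y.submatrix c2 c4 = 0
  y25 : Y.submatrix c2 c5 = 0
  y26 : Y.submatrix c2 c6 = 0
  y35 : Y.submatrix c3 c5 = 0
  y36 : Y.submatrix c3 c6 = 0
  y45 : Y.submatrix c4 c5 = 0
  y46 : Y.submatrix c4 c6 = 0
  y56 : Y.submatrix c5 c6 = 0
  y21 : Y.submatrix c2 c1 = 0
  y31 : Y.submatrix c3 c1 = 0
  y41 : Y.submatrix c4 c1 = 0
  y51 : Y.submatrix c5 c1 = 0

lemma YZ.of {Y : Matrix (Ix q r s t) (Ix q r s t) k} (hY : Pat Y) : YZ Y := by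
  constructor
  · exact hY.sub1 _ _ fun i j => by rw [c1_val, c2_val]; omega
  · exact hY.sub1 _ _ fun i j => by rw [c1_val, c3_val]; omega
  · exact hY.sub1 _ _ fun i j => by rw [c1_val, c4_val]; omega
  · exact hY.sub1 _ _ fun i j => by rw [c1_val, c5_val]; omega
  · exact hY.sub1 _ _ fun i j => by rw [c1_val, c6_val]; omega
  · exact hY.sub1 _ _ fun i j => by rw [c2_val, c3_val]; omega
  · exact hY.sub1 _ _ fun i j => by rw [c2_val, c4_val]; omega
  · exact hY.sub1 _ _ fun i j => by rw [c2_val, c5_val]; omega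
  · exact hY.sub1 _ _ fun i j => by rw [c2_val, c6_val]; omega
  · exact hY.sub1 _ _ fun i j => by rw [c3_val, c5_val]; omega
  · exact hY.sub1 _ _ fun i j => by rw [c3_val, c6_val]; omega
  · exact hY.sub1 _ _ fun i j => by rw [c4_val, c5_val]; omega
  · exact hY.sub1 _ _ fun i j => by rw [c4_val, c6_val]; omega
  · exact hY.sub1 _ _ fun i j => by rw [c5_val, c6_val]; omega
  · exact hY.sub2 _ fun i => by rw [c2_val]; omega
  · exact hY.sub2 _ fun i => by rw [c3_val]; omega
  · exact hY.sub2 _ fun i => by rw [c4_val]; omega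
  · exact hY.sub2 _ fun i => by rw [c5_val]; omega

/-- The zero blocks of a matrix in `K`. -/
structure KZ (κ : Matrix (Ix q r s t) (Ix q r s t) k) : Prop where
  k14 : κ.submatrix r1 r4 = 0
  k15 : κ.submatrix r1 r5 = 0
  k16 : κ.submatrix r1 r6 = 0
  k24 : κ.submatrix r2 r4 = 0
  k25 : κ.submatrix r2 r5 = 0
  k26 : κ.submatrix r2 r6 = 0
  k34 : κ.submatrix r3 r4 = 0
  k35 : κ.submatrix r3 r5 = 0
  k36 : κ.submatrix r3 r6 = 0
  k41 : κ.submatrix r4 r1 = 0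
  k42 : κ.submatrix r4 r2 = 0
  k43 : κ.submatrix r4 r3 = 0
  k51 : κ.submatrix r5 r1 = 0
  k52 : κ.submatrix r5 r2 = 0
  k53 : κ.submatrix r5 r3 = 0
  k61 : κ.submatrix r6 r1 = 0
  k62 : κ.submatrix r6 r2 = 0
  k63 : κ.submatrix r6 r3 = 0

lemma KZ.of {κ : Matrix (Ix q r s t) (Ix q r s t) k} (h : κ ∈ kDiag k q r s t) : KZ κ := by
  constructor <;> ext i j <;> refine h.2 _ _ ?_
  · rw [r1_val, r4_val]; omega
  · rw [r1_val, r5_val]; omega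
  · rw [r1_val, r6_val]; omega
  · rw [r2_val, r4_val]; omega
  · rw [r2_val, r5_val]; omega
  · rw [r2_val, r6_val]; omega
  · rw [r3_val, r4_val]; omega
  · rw [r3_val, r5_val]; omega
  · rw [r3_val, r6_val]; omega
  · rw [r4_val, r1_val]; omega
  · rw [r4_val, r2_val]; omega
  · rw [r4_val, r3_val]; omega
  · rw [r5_val, r1_val]; omega
  · rw [r5_val, r2_val]; omega
  · rw [r5_val, r3_val]; omega
  · rw [r6_val, r1_val]; omega
  · rw [r6_val, r2_val]; omega
  · rw [r6_val, r3_val]; omega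

lemma core {h h' Y κ : Matrix (Ix q r s t) (Ix q r s t) k} (H : HB h) (H' : HB h') (hY : Pat Y)
    (hκ : κ ∈ kDiag k q r s t) (hE : h * Y = κ * h')
    (hd : ∀ i : Ix q r s t, s + r + q + t ≤ (i : ℕ) → Y i i = 1) :
    Y.submatrix c1 c1 = 1 ∧
    Y.submatrix c2 c2 = 1 ∧
    Y.submatrix c5 c5 = 1 ∧
    Y.submatrix c6 c6 = 1 ∧
    Y.submatrix c3 c2 = 0 ∧
    Y.submatrix c4 c2 = 0 ∧
    Y.submatrix c5 c2 = 0 ∧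
    Y.submatrix c6 c2 = 0 ∧
    Y.submatrix c3 c4 = 0 ∧
    Y.submatrix c4 c3 = 0 ∧
    Y.submatrix c5 c3 = 0 ∧
    Y.submatrix c5 c4 = 0 ∧
    Y.submatrix c6 c1 = 0 ∧
    Y.submatrix c6 c3 = 0 ∧
    Y.submatrix c6 c4 = 0 ∧
    Y.submatrix c6 c5 = 0 ∧
    h.submatrix r1 c1 = Y.submatrix c3 c3 * h'.submatrix r1 c1 ∧
    h.submatrix r2 c1 = h'.submatrix r2 c1 ∧
    h.submatrix r4 c1 = Y.submatrix c4 c4 * h'.submatrix r4 c1 ∧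
    h.submatrix r5 c1 = h'.submatrix r5 c1 := by
  have Z := YZ.of hY
  have L := KZ.of hκ
  have E : ∀ {m m' : Type} (x : m → Ix q r s t) (y : m' → Ix q r s t),
      (h * Y).submatrix x y = (κ * h').submatrix x y := fun x y => by rw [hE]
  have e11 := E r1 c1
  rw [mul_c, mul_r] at e11
  simp only [H.h12, H.h13, H.h14, H.h15, H.h16, Z.y21, Z.y31, Z.y41, Z.y51, L.k14, L.k15, L.k16, H'.h31,
    Matrix.zero_mul, Matrix.mul_zero, add_zero, zero_add, Matrix.one_mul, Matrix.mul_one] at e11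
  have e12 := E r1 c2
  rw [mul_c, mul_r] at e12
  simp only [H.h12, H.h13, H.h14, H.h15, H.h16, Z.y12, L.k14, L.k15, L.k16, H'.h12, H'.h22, H'.h32,
    Matrix.zero_mul, Matrix.mul_zero, add_zero, zero_add, Matrix.one_mul, Matrix.mul_one] at e12
  have e13 := E r1 c3
  rw [mul_c, mul_r] at e13
  simp only [H.h12, H.h13, H.h14, H.h15, H.h16, Z.y13, Z.y23, L.k14, L.k15, L.k16, H'.h13, H'.h23, H'.h33,
    Matrix.zero_mul, Matrix.mul_zero, add_zero, zero_add, Matrix.one_mul, Matrix.mul_one] at e13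
  have e14 := E r1 c4
  rw [mul_c, mul_r] at e14
  simp only [H.h12, H.h13, H.h14, H.h15, H.h16, Z.y14, Z.y24, L.k14, L.k15, L.k16, H'.h14, H'.h24, H'.h34,
    Matrix.zero_mul, Matrix.mul_zero, add_zero, zero_add, Matrix.one_mul, Matrix.mul_one] at e14
  have e15 := E r1 c5
  rw [mul_c, mul_r] at e15
  simp only [H.h12, H.h13, H.h14, H.h15, H.h16, Z.y15, Z.y25, Z.y35, Z.y45, L.k14, L.k15, L.k16, H'.h15, H'.h25, H'.h35,
    Matrix.zero_mul, Matrix.mul_zero, add_zero, zero_add, Matrix.one_mul, Matrix.mul_one] at e15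
  have e16 := E r1 c6
  rw [mul_c, mul_r] at e16
  simp only [H.h12, H.h13, H.h14, H.h15, H.h16, Z.y16, Z.y26, Z.y36, Z.y46, Z.y56, L.k14, L.k15, L.k16, H'.h16, H'.h26, H'.h36,
    Matrix.zero_mul, Matrix.mul_zero, add_zero, zero_add, Matrix.one_mul, Matrix.mul_one] at e16
  have e21 := E r2 c1
  rw [mul_c, mul_r] at e21
  simp only [H.h22, H.h23, H.h24, H.h25, H.h26, Z.y21, Z.y31, Z.y41, Z.y51, L.k24, L.k25, L.k26, H'.h31,
    Matrix.zero_mul, Matrix.mul_zero, add_zero, zero_add, Matrix.one_mul, Matrix.mul_one] at e21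
  have e22 := E r2 c2
  rw [mul_c, mul_r] at e22
  simp only [H.h22, H.h23, H.h24, H.h25, H.h26, Z.y12, L.k24, L.k25, L.k26, H'.h12, H'.h22, H'.h32,
    Matrix.zero_mul, Matrix.mul_zero, add_zero, zero_add, Matrix.one_mul, Matrix.mul_one] at e22
  have e23 := E r2 c3
  rw [mul_c, mul_r] at e23
  simp only [H.h22, H.h23, H.h24, H.h25, H.h26, Z.y13, Z.y23, L.k24, L.k25, L.k26, H'.h13, H'.h23, H'.h33,
    Matrix.zero_mul, Matrix.mul_zero, add_zero, zero_add, Matrix.one_mul, Matrix.mul_one] at e23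
  have e24 := E r2 c4
  rw [mul_c, mul_r] at e24
  simp only [H.h22, H.h23, H.h24, H.h25, H.h26, Z.y14, Z.y24, L.k24, L.k25, L.k26, H'.h14, H'.h24, H'.h34,
    Matrix.zero_mul, Matrix.mul_zero, add_zero, zero_add, Matrix.one_mul, Matrix.mul_one] at e24
  have e25 := E r2 c5
  rw [mul_c, mul_r] at e25
  simp only [H.h22, H.h23, H.h24, H.h25, H.h26, Z.y15, Z.y25, Z.y35, Z.y45, L.k24, L.k25, L.k26, H'.h15, H'.h25, H'.h35,
    Matrix.zero_mul, Matrix.mul_zero, add_zero, zero_add, Matrix.one_mul, Matrix.mul_one] at e25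
  have e26 := E r2 c6
  rw [mul_c, mul_r] at e26
  simp only [H.h22, H.h23, H.h24, H.h25, H.h26, Z.y16, Z.y26, Z.y36, Z.y46, Z.y56, L.k24, L.k25, L.k26, H'.h16, H'.h26, H'.h36,
    Matrix.zero_mul, Matrix.mul_zero, add_zero, zero_add, Matrix.one_mul, Matrix.mul_one] at e26
  have e31 := E r3 c1
  rw [mul_c, mul_r] at e31
  simp only [H.h31, H.h32, H.h33, H.h34, H.h35, H.h36, Z.y21, Z.y31, Z.y41, Z.y51, L.k34, L.k35, L.k36, H'.h31,
    Matrix.zero_mul, Matrix.mul_zero, add_zero, zero_add, Matrix.one_mul, Matrix.mul_one] at e31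
  have e32 := E r3 c2
  rw [mul_c, mul_r] at e32
  simp only [H.h31, H.h32, H.h33, H.h34, H.h35, H.h36, Z.y12, L.k34, L.k35, L.k36, H'.h12, H'.h22, H'.h32,
    Matrix.zero_mul, Matrix.mul_zero, add_zero, zero_add, Matrix.one_mul, Matrix.mul_one] at e32
  have e33 := E r3 c3
  rw [mul_c, mul_r] at e33
  simp only [H.h31, H.h32, H.h33, H.h34, H.h35, H.h36, Z.y13, Z.y23, L.k34, L.k35, L.k36, H'.h13, H'.h23, H'.h33,
    Matrix.zero_mul, Matrix.mul_zero, add_zero, zero_add, Matrix.one_mul, Matrix.mul_one] at e33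
  have e34 := E r3 c4
  rw [mul_c, mul_r] at e34
  simp only [H.h31, H.h32, H.h33, H.h34, H.h35, H.h36, Z.y14, Z.y24, L.k34, L.k35, L.k36, H'.h14, H'.h24, H'.h34,
    Matrix.zero_mul, Matrix.mul_zero, add_zero, zero_add, Matrix.one_mul, Matrix.mul_one] at e34
  have e35 := E r3 c5
  rw [mul_c, mul_r] at e35
  simp only [H.h31, H.h32, H.h33, H.h34, H.h35, H.h36, Z.y15, Z.y25, Z.y35, Z.y45, L.k34, L.k35, L.k36, H'.h15, H'.h25, H'.h35,
    Matrix.zero_mul, Matrix.mul_zero, add_zero, zero_add, Matrix.one_mul, Matrix.mul_one] at e35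
  have e36 := E r3 c6
  rw [mul_c, mul_r] at e36
  simp only [H.h31, H.h32, H.h33, H.h34, H.h35, H.h36, Z.y16, Z.y26, Z.y36, Z.y46, Z.y56, L.k34, L.k35, L.k36, H'.h16, H'.h26, H'.h36,
    Matrix.zero_mul, Matrix.mul_zero, add_zero, zero_add, Matrix.one_mul, Matrix.mul_one] at e36
  have e41 := E r4 c1
  rw [mul_c, mul_r] at e41
  simp only [H.h42, H.h43, H.h44, H.h45, H.h46, Z.y21, Z.y31, Z.y41, Z.y51, L.k41, L.k42, L.k43, H'.h61,
    Matrix.zero_mul, Matrix.mul_zero, add_zero, zero_add, Matrix.one_mul, Matrix.mul_one] at e41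
  have e42 := E r4 c2
  rw [mul_c, mul_r] at e42
  simp only [H.h42, H.h43, H.h44, H.h45, H.h46, Z.y12, L.k41, L.k42, L.k43, H'.h42, H'.h52, H'.h62,
    Matrix.zero_mul, Matrix.mul_zero, add_zero, zero_add, Matrix.one_mul, Matrix.mul_one] at e42
  have e43 := E r4 c3
  rw [mul_c, mul_r] at e43
  simp only [H.h42, H.h43, H.h44, H.h45, H.h46, Z.y13, Z.y23, L.k41, L.k42, L.k43, H'.h43, H'.h53, H'.h63,
    Matrix.zero_mul, Matrix.mul_zero, add_zero, zero_add, Matrix.one_mul, Matrix.mul_one] at e43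
  have e44 := E r4 c4
  rw [mul_c, mul_r] at e44
  simp only [H.h42, H.h43, H.h44, H.h45, H.h46, Z.y14, Z.y24, L.k41, L.k42, L.k43, H'.h44, H'.h54, H'.h64,
    Matrix.zero_mul, Matrix.mul_zero, add_zero, zero_add, Matrix.one_mul, Matrix.mul_one] at e44
  have e45 := E r4 c5
  rw [mul_c, mul_r] at e45
  simp only [H.h42, H.h43, H.h44, H.h45, H.h46, Z.y15, Z.y25, Z.y35, Z.y45, L.k41, L.k42, L.k43, H'.h45, H'.h55, H'.h65,
    Matrix.zero_mul, Matrix.mul_zero, add_zero, zero_add, Matrix.one_mul, Matrix.mul_one] at e45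
  have e46 := E r4 c6
  rw [mul_c, mul_r] at e46
  simp only [H.h42, H.h43, H.h44, H.h45, H.h46, Z.y16, Z.y26, Z.y36, Z.y46, Z.y56, L.k41, L.k42, L.k43, H'.h46, H'.h56, H'.h66,
    Matrix.zero_mul, Matrix.mul_zero, add_zero, zero_add, Matrix.one_mul, Matrix.mul_one] at e46
  have e51 := E r5 c1
  rw [mul_c, mul_r] at e51
  simp only [H.h52, H.h53, H.h54, H.h55, H.h56, Z.y21, Z.y31, Z.y41, Z.y51, L.k51, L.k52, L.k53, H'.h61,
    Matrix.zero_mul, Matrix.mul_zero, add_zero, zero_add, Matrix.one_mul, Matrix.mul_one] at e51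
  have e52 := E r5 c2
  rw [mul_c, mul_r] at e52
  simp only [H.h52, H.h53, H.h54, H.h55, H.h56, Z.y12, L.k51, L.k52, L.k53, H'.h42, H'.h52, H'.h62,
    Matrix.zero_mul, Matrix.mul_zero, add_zero, zero_add, Matrix.one_mul, Matrix.mul_one] at e52
  have e53 := E r5 c3
  rw [mul_c, mul_r] at e53
  simp only [H.h52, H.h53, H.h54, H.h55, H.h56, Z.y13, Z.y23, L.k51, L.k52, L.k53, H'.h43, H'.h53, H'.h63,
    Matrix.zero_mul, Matrix.mul_zero, add_zero, zero_add, Matrix.one_mul, Matrix.mul_one] at e53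
  have e54 := E r5 c4
  rw [mul_c, mul_r] at e54
  simp only [H.h52, H.h53, H.h54, H.h55, H.h56, Z.y14, Z.y24, L.k51, L.k52, L.k53, H'.h44, H'.h54, H'.h64,
    Matrix.zero_mul, Matrix.mul_zero, add_zero, zero_add, Matrix.one_mul, Matrix.mul_one] at e54
  have e55 := E r5 c5
  rw [mul_c, mul_r] at e55
  simp only [H.h52, H.h53, H.h54, H.h55, H.h56, Z.y15, Z.y25, Z.y35, Z.y45, L.k51, L.k52, L.k53, H'.h45, H'.h55, H'.h65,
    Matrix.zero_mul, Matrix.mul_zero, add_zero, zero_add, Matrix.one_mul, Matrix.mul_one] at e55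
  have e56 := E r5 c6
  rw [mul_c, mul_r] at e56
  simp only [H.h52, H.h53, H.h54, H.h55, H.h56, Z.y16, Z.y26, Z.y36, Z.y46, Z.y56, L.k51, L.k52, L.k53, H'.h46, H'.h56, H'.h66,
    Matrix.zero_mul, Matrix.mul_zero, add_zero, zero_add, Matrix.one_mul, Matrix.mul_one] at e56
  have e61 := E r6 c1
  rw [mul_c, mul_r] at e61
  simp only [H.h61, H.h62, H.h63, H.h64, H.h65, H.h66, Z.y21, Z.y31, Z.y41, Z.y51, L.k61, L.k62, L.k63, H'.h61,
    Matrix.zero_mul, Matrix.mul_zero, add_zero, zero_add, Matrix.one_mul, Matrix.mul_one] at e61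
  have e62 := E r6 c2
  rw [mul_c, mul_r] at e62
  simp only [H.h61, H.h62, H.h63, H.h64, H.h65, H.h66, Z.y12, L.k61, L.k62, L.k63, H'.h42, H'.h52, H'.h62,
    Matrix.zero_mul, Matrix.mul_zero, add_zero, zero_add, Matrix.one_mul, Matrix.mul_one] at e62
  have e63 := E r6 c3
  rw [mul_c, mul_r] at e63
  simp only [H.h61, H.h62, H.h63, H.h64, H.h65, H.h66, Z.y13, Z.y23, L.k61, L.k62, L.k63, H'.h43, H'.h53, H'.h63,
    Matrix.zero_mul, Matrix.mul_zero, add_zero, zero_add, Matrix.one_mul, Matrix.mul_one] at e63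
  have e64 := E r6 c4
  rw [mul_c, mul_r] at e64
  simp only [H.h61, H.h62, H.h63, H.h64, H.h65, H.h66, Z.y14, Z.y24, L.k61, L.k62, L.k63, H'.h44, H'.h54, H'.h64,
    Matrix.zero_mul, Matrix.mul_zero, add_zero, zero_add, Matrix.one_mul, Matrix.mul_one] at e64
  have e65 := E r6 c5
  rw [mul_c, mul_r] at e65
  simp only [H.h61, H.h62, H.h63, H.h64, H.h65, H.h66, Z.y15, Z.y25, Z.y35, Z.y45, L.k61, L.k62, L.k63, H'.h45, H'.h55, H'.h65,
    Matrix.zero_mul, Matrix.mul_zero, add_zero, zero_add, Matrix.one_mul, Matrix.mul_one] at e65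
  have e66 := E r6 c6
  rw [mul_c, mul_r] at e66
  simp only [H.h61, H.h62, H.h63, H.h64, H.h65, H.h66, Z.y16, Z.y26, Z.y36, Z.y46, Z.y56, L.k61, L.k62, L.k63, H'.h46, H'.h56, H'.h66,
    Matrix.zero_mul, Matrix.mul_zero, add_zero, zero_add, Matrix.one_mul, Matrix.mul_one] at e66
  have y65 : Y.submatrix c6 c5 = 0 := by
    rw [e32, ← e65] at e62
    have := congrArg (fun M => M * Jm k r) e62
    simpa [Matrix.mul_assoc, Jm_sq] using this.symm
  rw [e22, ← e55, add_zero] at e52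
  rw [← e33, ← e35, e63, y65, Matrix.zero_mul, Matrix.zero_mul, add_zero] at e31
  rw [e31, ← e64, ← e65, ← e66, e34, y65, Matrix.zero_mul, Matrix.zero_mul, add_zero, zero_add, zero_add] at e61
  have low : ∀ {n : ℕ} (x : Fin n → Ix q r s t), (∀ i j, i < j → (x i : ℕ) < x j) →
      (∀ i, (x i : ℕ) < s + r ∨ s + r + q + t ≤ (x i : ℕ)) →
      ∀ i j, i < j → Y.submatrix x x i j = 0 := by
    intro n x h1 h2 i j hij
    have := h2 i
    have := h1 i j hij
    exact hY.z1 _ _ this (by omega)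
  obtain ⟨y22, y55⟩ := rigid _ _
    (low c2 (fun i j h => by rw [c2_val, c2_val]; omega) (fun i => by rw [c2_val]; omega))
    (low c5 (fun i j h => by rw [c5_val, c5_val]; omega) (fun i => by rw [c5_val]; omega))
    (fun i => hd _ (by rw [c5_val]; omega)) e52
  obtain ⟨y11, y66⟩ := rigid _ _
    (low c1 (fun i j h => by rw [c1_val, c1_val]; omega) (fun i => by rw [c1_val]; omega))
    (low c6 (fun i j h => by rw [c6_val, c6_val]; omega) (fun i => by rw [c6_val]; omega))
    (fun i => hd _ (by rw [c6_val]; omega)) e61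
  rw [y11, Matrix.mul_one, ← e13, ← e15, Matrix.zero_mul, add_zero] at e11
  rw [y11, Matrix.mul_one, ← e23, ← e25, e53, y55, Matrix.zero_mul, zero_add, Matrix.one_mul] at e21
  rw [y11, Matrix.mul_one, ← e44, ← e45, ← e46, Matrix.zero_mul, Matrix.zero_mul, add_zero, add_zero] at e41
  rw [y11, Matrix.mul_one, ← e54, ← e55, ← e56, e24, y55, Matrix.zero_mul, Matrix.zero_mul, Matrix.one_mul, zero_add,
    add_zero] at e51
  rw [← e45, Matrix.zero_mul] at e42
  exact ⟨y11, y22, y55, y66, e12, e42, e22, e32, e14, e43, e53, e24, e31, e63, e34, y65,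
    e11, e21, e41, e51⟩

end PartD

section PartF
variable {k : Type*} [Field k] {q r s t : ℕ}

lemma mid_mul' {A B : Matrix (Ix q r s t) (Ix q r s t) k} (hA : Pat A) (hB : Pat B)
    {m m' : Type*} (x : m → Ix q r s t) (y : m' → Ix q r s t)
    (hx : ∀ i, inBlk (s + r) (q + t) (x i : ℕ)) (hy : ∀ i, inBlk (s + r) (q + t) (y i : ℕ)) :
    (A * B).submatrix x y =
      A.submatrix x c3 * B.submatrix c3 y + A.submatrix x c4 * B.submatrix c4 y :=
  mid_mul hA hB x y hx hy

lemma in3 (i : Fin q) : inBlk (s + r) (q + t) ((c3 i : Ix q r s t) : ℕ) := by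
  rw [c3_val]; constructor <;> omega

lemma in4 (i : Fin t) : inBlk (s + r) (q + t) ((c4 i : Ix q r s t) : ℕ) := by
  rw [c4_val]; constructor <;> omega

/-- The middle blocks of a product of matrices with the pattern. -/
structure Mid (A : Matrix (Ix q r s t) (Ix q r s t) k) (a : Matrix (Fin q) (Fin q) k)
    (b : Matrix (Fin q) (Fin t) k) (c : Matrix (Fin t) (Fin q) k) (d : Matrix (Fin t) (Fin t) k) :
    Prop where
  m33 : A.submatrix c3 c3 = a
  m34 : A.submatrix c3 c4 = b
  m43 : A.submatrix c4 c3 = c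
  m44 : A.submatrix c4 c4 = d

lemma Mid.mul {A A' : Matrix (Ix q r s t) (Ix q r s t) k} {a b c d a' b' c' d'}
    (h : Mid A a b c d) (h' : Mid A' a' b' c' d') (hA : Pat A) (hA' : Pat A') :
    Mid (A * A') (a * a' + b * c') (a * b' + b * d') (c * a' + d * c') (c * b' + d * d') := by
  constructor
  · rw [mid_mul' hA hA' _ _ in3 in3, h.m33, h'.m33, h.m34, h'.m43]
  · rw [mid_mul' hA hA' _ _ in3 in4, h.m33, h'.m34, h.m34, h'.m44]
  · rw [mid_mul' hA hA' _ _ in4 in3, h.m43, h'.m33, h.m44, h'.m43]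
  · rw [mid_mul' hA hA' _ _ in4 in4, h.m43, h'.m34, h.m44, h'.m44]

lemma mid_of_one {A : Matrix (Ix q r s t) (Ix q r s t) k}
    (h : ∀ i j : Ix q r s t, inBlk (s + r) (q + t) (i : ℕ) → inBlk (s + r) (q + t) (j : ℕ) →
      A i j = if (i : ℕ) = j then 1 else 0) : Mid A 1 0 0 1 := by
  constructor <;> ext i j
  · rw [Matrix.submatrix_apply, h _ _ (in3 i) (in3 j), Matrix.one_apply, c3_val, c3_val]
    exact if_congr (by rw [Fin.ext_iff]; omega) rfl rfl
  · rw [Matrix.submatrix_apply, h _ _ (in3 i) (in4 j), c3_val, c4_val]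
    exact if_neg (by omega)
  · rw [Matrix.submatrix_apply, h _ _ (in4 i) (in3 j), c4_val, c3_val]
    exact if_neg (by omega)
  · rw [Matrix.submatrix_apply, h _ _ (in4 i) (in4 j), Matrix.one_apply, c4_val, c4_val]
    exact if_congr (by rw [Fin.ext_iff]; omega) rfl rfl

lemma mid_u {A : Matrix (Ix q r s t) (Ix q r s t) k} (h : A ∈ uPrime k q r s t) :
    Mid A 1 0 0 1 := by
  apply mid_of_one
  intro i j hi hj
  split_ifs with e
  · have : i = j := Fin.ext e
    rw [this, h.2.1]
  · exact h.2.2 i j hi hj e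

lemma mid_t {A : Matrix (Ix q r s t) (Ix q r s t) k} (h : A ∈ tPrime k q r s t) :
    Mid A 1 0 0 1 := by
  apply mid_of_one
  intro i j hi hj
  split_ifs with e
  · have : i = j := Fin.ext e
    rw [this, h.2.2 j hj.1]
  · exact h.1 i j e

lemma mid_q1 {A : Matrix (Ix q r s t) (Ix q r s t) k} (h : A ∈ qOne k q r s t) :
    Mid A 1 (A.submatrix c3 c4) 0 1 := by
  constructor
  · ext i j
    rw [Matrix.submatrix_apply, h, Matrix.one_apply, c3_val, c3_val]
    · exact if_congr (by rw [Fin.ext_iff]; omega) rfl rfl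
    · rw [c3_val, c3_val]; omega
  · rfl
  · ext i j
    rw [Matrix.submatrix_apply, h, c4_val, c3_val]
    · exact if_neg (by omega)
    · rw [c4_val, c3_val]; omega
  · ext i j
    rw [Matrix.submatrix_apply, h, Matrix.one_apply, c4_val, c4_val]
    · exact if_congr (by rw [Fin.ext_iff]; omega) rfl rfl
    · rw [c4_val, c4_val]; omega

lemma mid_q2 {A : Matrix (Ix q r s t) (Ix q r s t) k} (h : A ∈ qTwo k q r s t) :
    Mid A 1 0 (A.submatrix c4 c3) 1 := by
  constructor
  · ext i j
    rw [Matrix.submatrix_apply, h, Matrix.one_apply, c3_val, c3_val]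
    · exact if_congr (by rw [Fin.ext_iff]; omega) rfl rfl
    · rw [c3_val, c3_val]; omega
  · ext i j
    rw [Matrix.submatrix_apply, h, c3_val, c4_val]
    · exact if_neg (by omega)
    · rw [c4_val, c3_val]; omega
  · rfl
  · ext i j
    rw [Matrix.submatrix_apply, h, Matrix.one_apply, c4_val, c4_val]
    · exact if_congr (by rw [Fin.ext_iff]; omega) rfl rfl
    · rw [c4_val, c4_val]; omega

lemma qOne_ext {A B : Matrix (Ix q r s t) (Ix q r s t) k} (hA : A ∈ qOne k q r s t)
    (hB : B ∈ qOne k q r s t) (h : A.submatrix c3 c4 = B.submatrix c3 c4) : A = B := by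
  ext i j
  by_cases hij : inBlk (r + s) q (i : ℕ) ∧ inBlk ((r + s) + q) t (j : ℕ)
  · obtain ⟨⟨h1, h2⟩, h3, h4⟩ := hij
    have e1 : (c3 ⟨i - (s + r), by omega⟩ : Ix q r s t) = i := by
      ext; rw [c3_val]; dsimp only; omega
    have e2 : (c4 ⟨j - (s + r + q), by omega⟩ : Ix q r s t) = j := by
      ext; rw [c4_val]; dsimp only; omega
    rw [← e1, ← e2]
    exact congrFun (congrFun h _) _
  · rw [hA i j hij, hB i j hij]

lemma qTwo_ext {A B : Matrix (Ix q r s t) (Ix q r s t) k} (hA : A ∈ qTwo k q r s t)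
    (hB : B ∈ qTwo k q r s t) (h : A.submatrix c4 c3 = B.submatrix c4 c3) : A = B := by
  ext i j
  by_cases hij : inBlk ((r + s) + q) t (i : ℕ) ∧ inBlk (r + s) q (j : ℕ)
  · obtain ⟨⟨h3, h4⟩, h1, h2⟩ := hij
    have e1 : (c3 ⟨j - (s + r), by omega⟩ : Ix q r s t) = j := by
      ext; rw [c3_val]; dsimp only; omega
    have e2 : (c4 ⟨i - (s + r + q), by omega⟩ : Ix q r s t) = i := by
      ext; rw [c4_val]; dsimp only; omega
    rw [← e1, ← e2]
    exact congrFun (congrFun h _) _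
  · rw [hA i j hij, hB i j hij]

lemma sTilde_ext {g g' : Matrix (Ix q r s t) (Ix q r s t) k} (hg : g ∈ sTilde k q r s t)
    (hg' : g' ∈ sTilde k q r s t)
    (h1 : (g.submatrix id (sig q r s t)).submatrix r1 c1
      = (g'.submatrix id (sig q r s t)).submatrix r1 c1)
    (h2 : (g.submatrix id (sig q r s t)).submatrix r2 c1
      = (g'.submatrix id (sig q r s t)).submatrix r2 c1)
    (h4 : (g.submatrix id (sig q r s t)).submatrix r4 c1
      = (g'.submatrix id (sig q r s t)).submatrix r4 c1)
    (h5 : (g.submatrix id (sig q r s t)).submatrix r5 c1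
      = (g'.submatrix id (sig q r s t)).submatrix r5 c1) : g = g' := by
  have key : g.submatrix id (sig q r s t) = g'.submatrix id (sig q r s t) := by
    ext i j
    by_cases hs : ((j : ℕ) < s) ∧ ((i : ℕ) < q + r ∨ inBlk (q + r + s) (t + r) (i : ℕ))
    · obtain ⟨hj, hi⟩ := hs
      have ej : (c1 ⟨j, hj⟩ : Ix q r s t) = j := by ext; rw [c1_val]; dsimp only; omega
      rw [← ej]
      by_cases k1 : (i : ℕ) < q
      · have ei : (r1 ⟨i, k1⟩ : Ix q r s t) = i := by ext; rw [r1_val]; dsimp only; omega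
        rw [← ei]
        exact congrFun (congrFun h1 _) _
      by_cases k2 : (i : ℕ) < q + r
      · have ei : (r2 ⟨i - q, by omega⟩ : Ix q r s t) = i := by
          ext; rw [r2_val]; dsimp only; omega
        rw [← ei]
        exact congrFun (congrFun h2 _) _
      by_cases k4 : (i : ℕ) < q + r + s + t
      · have ei : (r4 ⟨i - (q + r + s), by omega⟩ : Ix q r s t) = i := by
          ext; rw [r4_val]; dsimp only; omega
        rw [← ei]
        exact congrFun (congrFun h4 _) _
      · have ei : (r5 ⟨i - (q + r + s + t), by omega⟩ : Ix q r s t) = i := by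
          ext; rw [r5_val]; dsimp only; omega
        rw [← ei]
        exact congrFun (congrFun h5 _) _
    · rw [hblk hg i j hs, hblk hg' i j hs]
  ext i j
  have := congrFun (congrFun key i) ((sig q r s t).symm j)
  simpa using this

lemma forall_c (p : Ix q r s t → Prop) (h1 : ∀ i, p (c1 i)) (h2 : ∀ i, p (c2 i))
    (h3 : ∀ i, p (c3 i)) (h4 : ∀ i, p (c4 i)) (h5 : ∀ i, p (c5 i)) (h6 : ∀ i, p (c6 i)) :
    ∀ x, p x := forall_six s r q t r s (by omega) p h1 h2 h3 h4 h5 h6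

lemma diag_blk {m : ℕ} (Y : Matrix (Ix q r s t) (Ix q r s t) k) (x : Fin m → Ix q r s t)
    (hx : Function.Injective x) (h : Y.submatrix x x = 1) (i j : Fin m) :
    Y (x i) (x j) = (1 : Matrix (Ix q r s t) (Ix q r s t) k) (x i) (x j) := by
  have := congrFun (congrFun h i) j
  rw [Matrix.submatrix_apply] at this
  rw [this, Matrix.one_apply, Matrix.one_apply]
  simp [hx.eq_iff]

lemma off_blk {m m' : ℕ} (Y : Matrix (Ix q r s t) (Ix q r s t) k) (x : Fin m → Ix q r s t)
    (y : Fin m' → Ix q r s t) (h : Y.submatrix x y = 0) (hxy : ∀ i j, (x i : ℕ) ≠ y j) (i j) :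
    Y (x i) (y j) = (1 : Matrix (Ix q r s t) (Ix q r s t) k) (x i) (y j) := by
  have := congrFun (congrFun h i) j
  rw [Matrix.submatrix_apply] at this
  rw [this, Matrix.one_apply_ne]
  · rfl
  · exact fun e => hxy i j (congrArg Fin.val e)

lemma emb_inj {n off len : ℕ} (h : off + len ≤ n) : Function.Injective (emb off len h : Fin len → Fin n) := by
  intro i j e
  have := congrArg Fin.val e
  rw [emb_val, emb_val] at this
  ext; omega

lemma eq_one_of_blocks {Y : Matrix (Ix q r s t) (Ix q r s t) k} (Z : YZ Y)
    (y11 : Y.submatrix c1 c1 = 1)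
    (y22 : Y.submatrix c2 c2 = 1)
    (y33 : Y.submatrix c3 c3 = 1)
    (y44 : Y.submatrix c4 c4 = 1)
    (y55 : Y.submatrix c5 c5 = 1)
    (y66 : Y.submatrix c6 c6 = 1)
    (y32 : Y.submatrix c3 c2 = 0)
    (y42 : Y.submatrix c4 c2 = 0)
    (y52 : Y.submatrix c5 c2 = 0)
    (y62 : Y.submatrix c6 c2 = 0)
    (y34 : Y.submatrix c3 c4 = 0)
    (y43 : Y.submatrix c4 c3 = 0)
    (y53 : Y.submatrix c5 c3 = 0)
    (y54 : Y.submatrix c5 c4 = 0)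
    (y61 : Y.submatrix c6 c1 = 0)
    (y63 : Y.submatrix c6 c3 = 0)
    (y64 : Y.submatrix c6 c4 = 0)
    (y65 : Y.submatrix c6 c5 = 0)
    : Y = 1 := by
  refine Matrix.ext (forall_c _ ?_ ?_ ?_ ?_ ?_ ?_) <;> intro i <;>
    refine forall_c _ ?_ ?_ ?_ ?_ ?_ ?_ <;> intro j
  · exact diag_blk Y c1 (emb_inj _) y11 i j
  · exact off_blk Y c1 c2 Z.y12 (fun i j => by rw [c1_val, c2_val]; omega) i j
  · exact off_blk Y c1 c3 Z.y13 (fun i j => by rw [c1_val, c3_val]; omega) i j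
  · exact off_blk Y c1 c4 Z.y14 (fun i j => by rw [c1_val, c4_val]; omega) i j
  · exact off_blk Y c1 c5 Z.y15 (fun i j => by rw [c1_val, c5_val]; omega) i j
  · exact off_blk Y c1 c6 Z.y16 (fun i j => by rw [c1_val, c6_val]; omega) i j
  · exact off_blk Y c2 c1 Z.y21 (fun i j => by rw [c2_val, c1_val]; omega) i j
  · exact diag_blk Y c2 (emb_inj _) y22 i j
  · exact off_blk Y c2 c3 Z.y23 (fun i j => by rw [c2_val, c3_val]; omega) i j
  · exact off_blk Y c2 c4 Z.y24 (fun i j => by rw [c2_val, c4_val]; omega) i j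
  · exact off_blk Y c2 c5 Z.y25 (fun i j => by rw [c2_val, c5_val]; omega) i j
  · exact off_blk Y c2 c6 Z.y26 (fun i j => by rw [c2_val, c6_val]; omega) i j
  · exact off_blk Y c3 c1 Z.y31 (fun i j => by rw [c3_val, c1_val]; omega) i j
  · exact off_blk Y c3 c2 y32 (fun i j => by rw [c3_val, c2_val]; omega) i j
  · exact diag_blk Y c3 (emb_inj _) y33 i j
  · exact off_blk Y c3 c4 y34 (fun i j => by rw [c3_val, c4_val]; omega) i j
  · exact off_blk Y c3 c5 Z.y35 (fun i j => by rw [c3_val, c5_val]; omega) i j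
  · exact off_blk Y c3 c6 Z.y36 (fun i j => by rw [c3_val, c6_val]; omega) i j
  · exact off_blk Y c4 c1 Z.y41 (fun i j => by rw [c4_val, c1_val]; omega) i j
  · exact off_blk Y c4 c2 y42 (fun i j => by rw [c4_val, c2_val]; omega) i j
  · exact off_blk Y c4 c3 y43 (fun i j => by rw [c4_val, c3_val]; omega) i j
  · exact diag_blk Y c4 (emb_inj _) y44 i j
  · exact off_blk Y c4 c5 Z.y45 (fun i j => by rw [c4_val, c5_val]; omega) i j
  · exact off_blk Y c4 c6 Z.y46 (fun i j => by rw [c4_val, c6_val]; omega) i j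
  · exact off_blk Y c5 c1 Z.y51 (fun i j => by rw [c5_val, c1_val]; omega) i j
  · exact off_blk Y c5 c2 y52 (fun i j => by rw [c5_val, c2_val]; omega) i j
  · exact off_blk Y c5 c3 y53 (fun i j => by rw [c5_val, c3_val]; omega) i j
  · exact off_blk Y c5 c4 y54 (fun i j => by rw [c5_val, c4_val]; omega) i j
  · exact diag_blk Y c5 (emb_inj _) y55 i j
  · exact off_blk Y c5 c6 Z.y56 (fun i j => by rw [c5_val, c6_val]; omega) i j
  · exact off_blk Y c6 c1 y61 (fun i j => by rw [c6_val, c1_val]; omega) i j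
  · exact off_blk Y c6 c2 y62 (fun i j => by rw [c6_val, c2_val]; omega) i j
  · exact off_blk Y c6 c3 y63 (fun i j => by rw [c6_val, c3_val]; omega) i j
  · exact off_blk Y c6 c4 y64 (fun i j => by rw [c6_val, c4_val]; omega) i j
  · exact off_blk Y c6 c5 y65 (fun i j => by rw [c6_val, c5_val]; omega) i j
  · exact diag_blk Y c6 (emb_inj _) y66 i j

lemma diag_one_of {u1 u2 u3 u4 : Matrix (Ix q r s t) (Ix q r s t) k}
    (h1 : u1 ∈ uPrime k q r s t) (p1 : Pat u1) (h2 : u2 ∈ tPrime k q r s t)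
    (h3 : u3 ∈ qOne k q r s t) (h4 : u4 ∈ qTwo k q r s t) (i : Ix q r s t)
    (hi : s + r + q + t ≤ (i : ℕ)) : (u1 * u2 * u3 * u4) i i = 1 := by
  have p2 := pat_t h2
  have p3 := pat_q1 h3
  have p4 := pat_q2 h4
  rw [diag_mul ((p1.mul p2).mul p3) p4 i (Or.inr hi), diag_mul (p1.mul p2) p3 i (Or.inr hi),
    diag_mul p1 p2 i (Or.inr hi), h1.2.1, h2.2.2 i (by omega),
    h3 i i (by rintro ⟨⟨_, _⟩, _, _⟩; omega), h4 i i (by rintro ⟨⟨_, _⟩, _, _⟩; omega)]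
  simp

lemma inj_main {g g' u1 u2 u3 u4 v1 v2 v3 v4 κ : Matrix (Ix q r s t) (Ix q r s t) k}
    (hg : g ∈ sTilde k q r s t) (hg' : g' ∈ sTilde k q r s t)
    (h1 : u1 ∈ uPrime k q r s t) (p1 : Pat u1) (h2 : u2 ∈ tPrime k q r s t)
    (h3 : u3 ∈ qOne k q r s t) (h4 : u4 ∈ qTwo k q r s t)
    (h1' : v1 ∈ uPrime k q r s t) (p1' : Pat v1) (h2' : v2 ∈ tPrime k q r s t)
    (h3' : v3 ∈ qOne k q r s t) (h4' : v4 ∈ qTwo k q r s t)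
    (hκ : κ ∈ kDiag k q r s t)
    (hE : g'.submatrix id (sig q r s t) * (v1 * v2 * v3 * v4)
      = κ * (g.submatrix id (sig q r s t) * (u1 * u2 * u3 * u4))) :
    g = g' ∧ u1 = v1 ∧ u2 = v2 ∧ u3 = v3 ∧ u4 = v4 := by
  have p2 := pat_t h2
  have p3 := pat_q1 h3
  have p4 := pat_q2 h4
  have p2' := pat_t h2'
  have p3' := pat_q1 h3'
  have p4' := pat_q2 h4'
  have a2 := isUnit_tPrime h2
  have a3 := isUnit_qOne h3
  have a4 := isUnit_qTwo h4
  have hpM := ((p1.mul p2).mul p3).mul p4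
  have hpM' := ((p1'.mul p2').mul p3').mul p4'
  have hdM := diag_one_of h1 p1 h2 h3 h4
  have hdM' := diag_one_of h1' p1' h2' h3' h4'
  have hm := (((mid_u h1).mul (mid_t h2) p1 p2).mul (mid_q1 h3) (p1.mul p2) p3).mul
    (mid_q2 h4) ((p1.mul p2).mul p3) p4
  have hm' := (((mid_u h1').mul (mid_t h2') p1' p2').mul (mid_q1 h3') (p1'.mul p2') p3').mul
    (mid_q2 h4') ((p1'.mul p2').mul p3') p4'
  simp only [Matrix.zero_mul, Matrix.mul_zero, Matrix.one_mul, Matrix.mul_one, add_zero,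
    zero_add] at hm hm'
  have huM' : IsUnit (v1 * v2 * v3 * v4) := (((isUnit_uPrime h1').mul (isUnit_tPrime h2')).mul
    (isUnit_qOne h3')).mul (isUnit_qTwo h4')
  have hMdef : ∃ M, M = u1 * u2 * u3 * u4 := ⟨_, rfl⟩
  obtain ⟨M, hM⟩ := hMdef
  have hMdef' : ∃ M, M = v1 * v2 * v3 * v4 := ⟨_, rfl⟩
  obtain ⟨M', hM'⟩ := hMdef'
  rw [← hM] at hE hpM hdM hm
  rw [← hM'] at hE hpM' hdM' hm' huM'
  have hpY : Pat (M * M'⁻¹) := hpM.mul (hpM'.inv huM')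
  have hi := isUnit_inv' huM'
  have hk := isUnit_inv' hκ.1
  have hYM : M * M'⁻¹ * M' = M := by rw [mul_assoc, hi.2.2, mul_one]
  have hEq : g.submatrix id (sig q r s t) * (M * M'⁻¹) = κ⁻¹ * g'.submatrix id (sig q r s t) := by
    have := congrArg (fun X => κ⁻¹ * X * M'⁻¹) hE
    simp only [mul_assoc, hi.2.1, mul_one] at this
    rw [this, ← mul_assoc κ⁻¹, hk.2.2, one_mul]
  generalize hYd : M * M'⁻¹ = Y at hpY hYM hEq
  have hdY : ∀ i : Ix q r s t, s + r + q + t ≤ (i : ℕ) → Y i i = 1 := by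
    intro i hi
    have := diag_mul hpY hpM' i (Or.inr hi)
    rw [hYM, hdM i hi, hdM' i hi, mul_one] at this
    exact this.symm
  obtain ⟨y11, y22, y55, y66, y32, y42, y52, y62, y34, y43, y53, y54, y61, y63, y64, y65,
    x1, x2, x4, x5⟩ := core (HB.of hg) (HB.of hg') hpY (kDiag_inv hκ) hEq hdY
  have hmY := Mid.mul (A := Y) ⟨rfl, y34, y43, rfl⟩ hm' hpY hpM'
  rw [hYM] at hmY
  simp only [Matrix.zero_mul, Matrix.mul_one, add_zero, zero_add] at hmY
  have y44 : Y.submatrix c4 c4 = 1 := hmY.m44.symm.trans hm.m44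
  have b34 := hmY.m34.symm.trans hm.m34
  have b43 := hmY.m43.symm.trans hm.m43
  have b33 := hmY.m33.symm.trans hm.m33
  rw [y44, Matrix.one_mul] at b43
  rw [Matrix.mul_add, Matrix.mul_one, ← Matrix.mul_assoc, b34, b43] at b33
  have y33 : Y.submatrix c3 c3 = 1 := add_right_cancel b33
  have hY1 : Y = 1 := eq_one_of_blocks (YZ.of hpY) y11 y22 y33 y44 y55 y66 y32 y42 y52 y62 y34 y43
    y53 y54 y61 y63 y64 y65
  rw [y33, Matrix.one_mul] at x1 b34
  rw [y44, Matrix.one_mul] at x4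
  have e3 : u3 = v3 := qOne_ext h3 h3' b34.symm
  have e4 : u4 = v4 := qTwo_ext h4 h4' b43.symm
  rw [hY1, one_mul, hM, hM', ← e3, ← e4] at hYM
  have e12 := a3.mul_right_cancel (a4.mul_right_cancel hYM)
  have e2 : u2 = v2 := by
    ext i j
    by_cases hij : (i : ℕ) = j
    · have : i = j := Fin.ext hij
      subst this
      by_cases hi : (i : ℕ) < s + r
      · have := congrFun (congrFun e12 i) i
        rw [diag_mul p1' p2' i (Or.inl hi), diag_mul p1 p2 i (Or.inl hi), h1.2.1, h1'.2.1,
          one_mul, one_mul] at this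
        exact this.symm
      · rw [h2.2.2 i (by omega), h2'.2.2 i (by omega)]
    · rw [h2.1 i j hij, h2'.1 i j hij]
  rw [← e2] at e12
  exact ⟨sTilde_ext hg hg' x1 x2 x4 x5, (a2.mul_right_cancel e12).symm, e2, e3, e4⟩

lemma prod_conj (w g u1 u2 u3 u4 : Matrix (Ix q r s t) (Ix q r s t) k) (hw : w * w⁻¹ = 1) :
    g * (w⁻¹ * u1 * w) * (w⁻¹ * u2 * w) * (w⁻¹ * u3 * w) * (w⁻¹ * u4 * w) * w⁻¹
      = g * w⁻¹ * (u1 * u2 * u3 * u4) := by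
  have hc : ∀ X, w * (w⁻¹ * X) = X := fun X => by rw [← mul_assoc, hw, one_mul]
  simp only [mul_assoc, hc, hw, mul_one]
end PartF


/-- (a) The conjugated sets `w⁻¹U'_{+,w}w`, `w⁻¹T'w`, `w⁻¹Q₁w`,
`w⁻¹Q₂w` all lie in `P'`; (b) the map `Ψ : S̃ × Z → K\GL(a+b,k)`,
`(g, (z₁,z₂,z₃,z₄)) ↦ K·g·z₁z₂z₃z₄`, is injective; (c) for every subset `D ⊆ GL(a+b,k)`
with `K·D·P' = D`, `Ψ` restricts to a bijection from `(S̃ ∩ D) × Z` onto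
`{Kx : x ∈ D} ∩ Ψ(S̃ × Z)`. -/
theorem stmt11 (k : Type*) [Field k] (q r s t : ℕ)
    (hq : 1 ≤ q) (hr : 1 ≤ r) (hs : 1 ≤ s) (ht : 1 ≤ t) :
    let w := wMat k q r s t
    let Z₁ := (fun u => w⁻¹ * u * w) ''
      (uPrime k q r s t ∩ ((fun u => w * u * w⁻¹) '' uPlus k q r s t))
    let Z₂ := (fun u => w⁻¹ * u * w) '' tPrime k q r s t
    let Z₃ := (fun u => w⁻¹ * u * w) '' qOne k q r s t
    let Z₄ := (fun u => w⁻¹ * u * w) '' qTwo k q r s t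
    -- (a)
    ((∀ z ∈ Z₁, z ∈ pPrime k q r s t) ∧ (∀ z ∈ Z₂, z ∈ pPrime k q r s t) ∧
     (∀ z ∈ Z₃, z ∈ pPrime k q r s t) ∧ (∀ z ∈ Z₄, z ∈ pPrime k q r s t)) ∧
    -- (b) injectivity of Ψ
    (∀ g ∈ sTilde k q r s t, ∀ g' ∈ sTilde k q r s t,
      ∀ z₁ ∈ Z₁, ∀ z₁' ∈ Z₁, ∀ z₂ ∈ Z₂, ∀ z₂' ∈ Z₂, ∀ z₃ ∈ Z₃, ∀ z₃' ∈ Z₃,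
      ∀ z₄ ∈ Z₄, ∀ z₄' ∈ Z₄,
      (∃ κ ∈ kDiag k q r s t, g' * z₁' * z₂' * z₃' * z₄' = κ * (g * z₁ * z₂ * z₃ * z₄)) →
      g = g' ∧ z₁ = z₁' ∧ z₂ = z₂' ∧ z₃ = z₃' ∧ z₄ = z₄') ∧
    -- (c) restriction to a K·D·P' = D
    (∀ D : Set (Matrix (Fin (q + r + s + (t + r + s))) (Fin (q + r + s + (t + r + s))) k),
      (∀ x ∈ D, IsUnit x) →
      (∀ x, x ∈ D ↔ ∃ κ ∈ kDiag k q r s t, ∃ y ∈ D, ∃ π ∈ pPrime k q r s t, x = κ * y * π) →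
      (∀ g ∈ sTilde k q r s t ∩ D, ∀ z₁ ∈ Z₁, ∀ z₂ ∈ Z₂, ∀ z₃ ∈ Z₃, ∀ z₄ ∈ Z₄,
        g * z₁ * z₂ * z₃ * z₄ ∈ D) ∧
      (∀ x ∈ D,
        (∃ g ∈ sTilde k q r s t, ∃ z₁ ∈ Z₁, ∃ z₂ ∈ Z₂, ∃ z₃ ∈ Z₃, ∃ z₄ ∈ Z₄,
          ∃ κ ∈ kDiag k q r s t, x = κ * (g * z₁ * z₂ * z₃ * z₄)) →
        ∃ g ∈ sTilde k q r s t ∩ D, ∃ z₁ ∈ Z₁, ∃ z₂ ∈ Z₂, ∃ z₃ ∈ Z₃, ∃ z₄ ∈ Z₄,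
          ∃ κ ∈ kDiag k q r s t, x = κ * (g * z₁ * z₂ * z₃ * z₄))) := by
  intro w Z₁ Z₂ Z₃ Z₄
  have hw : w * w⁻¹ = 1 := (wMat_unit k q r s t).2
  have A1 : ∀ z ∈ Z₁, z ∈ pPrime k q r s t := by
    rintro z ⟨u, ⟨h, h'⟩, rfl⟩
    exact partA1 h h'
  have A2 : ∀ z ∈ Z₂, z ∈ pPrime k q r s t := by
    rintro z ⟨u, h, rfl⟩
    exact partA2 h
  have A3 : ∀ z ∈ Z₃, z ∈ pPrime k q r s t := by
    rintro z ⟨u, h, rfl⟩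
    exact partA3 h
  have A4 : ∀ z ∈ Z₄, z ∈ pPrime k q r s t := by
    rintro z ⟨u, h, rfl⟩
    exact partA4 h
  refine ⟨⟨A1, A2, A3, A4⟩, ?_, ?_⟩
  · rintro g hg g' hg' _ ⟨u1, ⟨h1, h1p⟩, rfl⟩ _ ⟨v1, ⟨h1', h1p'⟩, rfl⟩ _ ⟨u2, h2, rfl⟩
      _ ⟨v2, h2', rfl⟩ _ ⟨u3, h3, rfl⟩ _ ⟨v3, h3', rfl⟩ _ ⟨u4, h4, rfl⟩ _ ⟨v4, h4', rfl⟩ ⟨κ, hκ, hE⟩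
    have hE' := congrArg (fun X => X * w⁻¹) hE
    simp only at hE'
    rw [prod_conj w _ _ _ _ _ hw, mul_assoc κ, prod_conj w _ _ _ _ _ hw, mul_wInv, mul_wInv] at hE'
    obtain ⟨e, e1, e2, e3, e4⟩ := inj_main hg hg' h1 (pat_u h1 h1p) h2 h3 h4 h1' (pat_u h1' h1p')
      h2' h3' h4' hκ hE'
    subst e e1 e2 e3 e4
    exact ⟨rfl, rfl, rfl, rfl, rfl⟩
  · intro D hDu hD
    have R : ∀ y ∈ D, ∀ z ∈ pPrime k q r s t, y * z ∈ D := fun y hy z hz =>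
      (hD _).mpr ⟨1, one_mem_kDiag, y, hy, z, hz, by rw [one_mul]⟩
    have L : ∀ κ ∈ kDiag k q r s t, ∀ y ∈ D, κ * y ∈ D := fun κ hκ y hy =>
      (hD _).mpr ⟨κ, hκ, y, hy, 1, one_mem_pPrime, by rw [mul_one]⟩
    refine ⟨?_, ?_⟩
    · intro g hg z₁ h1 z₂ h2 z₃ h3 z₄ h4
      exact R _ (R _ (R _ (R _ hg.2 _ (A1 _ h1)) _ (A2 _ h2)) _ (A3 _ h3)) _ (A4 _ h4)
    · rintro x hx ⟨g, hg, z₁, h1, z₂, h2, z₃, h3, z₄, h4, κ, hκ, rfl⟩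
      refine ⟨g, ⟨hg, ?_⟩, z₁, h1, z₂, h2, z₃, h3, z₄, h4, κ, hκ, rfl⟩
      have := R _ (R _ (R _ (R _ (L _ (kDiag_inv hκ) _ hx) _ (pPrime_inv (A4 _ h4))) _
        (pPrime_inv (A3 _ h3))) _ (pPrime_inv (A2 _ h2))) _ (pPrime_inv (A1 _ h1))
      have c1 := (isUnit_inv' (A1 _ h1).1).2.1
      have c2 := (isUnit_inv' (A2 _ h2).1).2.1
      have c3 := (isUnit_inv' (A3 _ h3).1).2.1
      have c4 := (isUnit_inv' (A4 _ h4).1).2.1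
      have c0 := (isUnit_inv' hκ.1).2.2
      rw [← mul_assoc κ⁻¹, c0, one_mul, mul_assoc _ z₄, c4, mul_one, mul_assoc _ z₃, c3, mul_one,
        mul_assoc _ z₂, c2, mul_one, mul_assoc _ z₁, c1, mul_one] at this
      exact this
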